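/- arXiv:1310.6155 — 9 statements merged into one kernel-verified Lean document; each statement's English description precedes it below -/
import Mathlib

section
/- Let u, u' be complex numbers. The couple (u,u') is admissible if and only if either u is non-real and u' equals the complex conjugate of u, or u and u' are both real and there exists an integer m such that m < u < m+1 and m < u' < m+1. -/
/-- A couple `(u, u')` of complex numbers is *admissible* if for every integer `l`
the number `(u - l) * (u' - l)` is real and strictly positive. -/
def Admissible (u u' : ℂ) : Prop :=
  ∀ l : ℤ, ((u - l) * (u' - l)).im = 0 ∧ 0 < ((u - l) * (u' - l)).re

/-- Classification of admissible couples: `(u, u')` is admissible iff either `u` is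
non-real and `u'` is its complex conjugate, or `u, u'` are both real and there is an
integer `m` with `m < u < m + 1` and `m < u' < m + 1`. -/
theorem admissible_iff (u u' : ℂ) :
    Admissible u u' ↔
      ((u.im ≠ 0 ∧ u' = (starRingEnd ℂ) u) ∨
       (u.im = 0 ∧ u'.im = 0 ∧
         ∃ m : ℤ, ((m : ℝ) < u.re ∧ u.re < m + 1) ∧ ((m : ℝ) < u'.re ∧ u'.re < m + 1))) := by
  simp only [Admissible, Complex.mul_re, Complex.mul_im, Complex.sub_re, Complex.sub_im,
    Complex.intCast_re, Complex.intCast_im, sub_zero]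
  constructor
  · intro h
    have him : u'.im = -u.im := by
      have h₀ := (h 0).1
      have h₁ := (h 1).1
      push_cast at h₀ h₁
      linarith
    by_cases hu : u.im = 0
    · have hu' : u'.im = 0 := by rw [him, hu, neg_zero]
      refine Or.inr ⟨hu, hu', ⌊u.re⌋, ?_⟩
      have hpos (l : ℤ) : 0 < (u.re - l) * (u'.re - l) := by simpa [hu] using (h l).2
      have hle := Int.floor_le u.re
      have hlt := Int.lt_floor_add_one u.re
      have hfloor := hpos ⌊u.re⌋
      have hceil := hpos (⌊u.re⌋ + 1)
      push_cast at hceil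
      have hu'_gt := pos_of_mul_pos_right hfloor (sub_nonneg.2 hle)
      have hu_gt := pos_of_mul_pos_left hfloor hu'_gt.le
      have hu'_lt := neg_of_mul_pos_right hceil (sub_nonpos.2 hlt.le)
      exact ⟨⟨by linarith, hlt⟩, by linarith, by linarith⟩
    · refine Or.inl ⟨hu, Complex.ext ?_ him⟩
      have h₀ := (h 0).1
      rw [him] at h₀
      apply mul_left_cancel₀ hu
      push_cast at h₀
      rw [Complex.conj_re]
      linarith
  · rintro (⟨hu, rfl⟩ | ⟨hu, hu', m, ⟨h₁, h₂⟩, h₃, h₄⟩) l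
    · rw [Complex.conj_re, Complex.conj_im]
      refine ⟨by ring, ?_⟩
      nlinarith [sq_nonneg (u.re - l), pow_pos (abs_pos.2 hu) 2, sq_abs u.im]
    · refine ⟨by simp [hu, hu'], ?_⟩
      rw [hu, zero_mul, sub_zero]
      rcases le_or_gt l m with hl | hl
      · have : (l : ℝ) ≤ m := by exact_mod_cast hl
        exact mul_pos (by linarith) (by linarith)
      · have : (m : ℝ) + 1 ≤ l := by exact_mod_cast hl
        exact mul_pos_of_neg_of_neg (by linarith) (by linarith)
end

section
/- Dougall's bilateral series identity: let (u,u') and (v,v') be admissible couples with u+u'+v+v' > −1. Then the family (W(l))_{l∈ℤ} is summable and ∑_{l∈ℤ} W(l) = Γ(u+u'+v+v'+1)/(Γ(u+v+1)·Γ(u+v'+1)·Γ(u'+v+1)·Γ(u'+v'+1)). -/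
/-- `W l = 1 / (Γ(u+1-l) Γ(u'+1-l) Γ(v+1+l) Γ(v'+1+l))`. -/
noncomputable def W (u u' v v' : ℂ) (l : ℤ) : ℂ :=
  1 / (Complex.Gamma (u + 1 - l) * Complex.Gamma (u' + 1 - l) *
       Complex.Gamma (v + 1 + l) * Complex.Gamma (v' + 1 + l))

namespace Dougall

open Filter Topology Asymptotics

/-- The product `1 / (Γ(x - l) Γ(y + l))`. -/
noncomputable def recipGammaPair (x y : ℂ) (l : ℤ) : ℂ :=
  (Complex.Gamma (x - l))⁻¹ * (Complex.Gamma (y + l))⁻¹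

lemma recipGammaPair_neg (x y : ℂ) (l : ℤ) :
    recipGammaPair x y (-l) = recipGammaPair y x l := by
  simp [recipGammaPair, mul_comm, sub_eq_add_neg]

lemma Gamma_add_nat_add_one {z : ℂ} (hz : ∀ m : ℤ, z ≠ m) {n : ℕ} (hn : 0 < n) :
    Complex.Gamma (z + (n + 1)) =
      Complex.Gamma z / Complex.GammaSeq z n * ((n : ℂ) ^ z * n.factorial) := by
  have hne : ∀ j : ℕ, z + j ≠ 0 := fun j h ↦ hz (-j) (by push_cast; linear_combination h)
  have key : ∀ k : ℕ, Complex.Gamma (z + k) =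
      Complex.Gamma z * ∏ j ∈ Finset.range k, (z + j) := by
    intro k
    induction k with
    | zero => simp
    | succ k ih =>
      rw [Finset.prod_range_succ, ← mul_assoc, ← ih]
      push_cast
      rw [← add_assoc, Complex.Gamma_add_one _ (hne k), mul_comm]
  have h := key (n + 1)
  push_cast at h
  rw [h, Complex.GammaSeq]
  have hprod : ∏ j ∈ Finset.range (n + 1), (z + j) ≠ 0 :=
    Finset.prod_ne_zero_iff.2 fun j _ ↦ hne j
  have hpow : (n : ℂ) ^ z ≠ 0 := by
    rw [Ne, Complex.cpow_eq_zero_iff]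
    rintro ⟨h, -⟩
    exact hn.ne' (by exact_mod_cast h)
  have hfac : (n.factorial : ℂ) ≠ 0 := by exact_mod_cast n.factorial_ne_zero
  field_simp

lemma Gamma_ne_zero_of_ne_int {z : ℂ} (hz : ∀ m : ℤ, z ≠ m) : Complex.Gamma z ≠ 0 :=
  Complex.Gamma_ne_zero fun m h ↦ hz (-m) (by push_cast; exact h)

lemma tendsto_Gamma_div_GammaSeq {z : ℂ} (hz : ∀ m : ℤ, z ≠ m) :
    Tendsto (fun n : ℕ ↦ Complex.Gamma z / Complex.GammaSeq z n) atTop (𝓝 1) := by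
  have h := (tendsto_const_nhds (x := Complex.Gamma z)).div (Complex.GammaSeq_tendsto_Gamma z)
    (Gamma_ne_zero_of_ne_int hz)
  rwa [div_self (Gamma_ne_zero_of_ne_int hz)] at h

lemma isBigO_Gamma_div_Gamma {x y : ℂ} (hx : ∀ m : ℤ, x ≠ m) (hy : ∀ m : ℤ, y ≠ m) :
    (fun n : ℕ ↦ Complex.Gamma (x + (n + 1)) / Complex.Gamma (y + (n + 1)))
      =O[atTop] (fun n : ℕ ↦ (n : ℝ) ^ (x - y).re) := by
  have h1 := (tendsto_Gamma_div_GammaSeq hx).div (tendsto_Gamma_div_GammaSeq hy) one_ne_zero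
  have h2 : (fun n : ℕ ↦ (n : ℂ) ^ (x - y)) =O[atTop] (fun n : ℕ ↦ (n : ℝ) ^ (x - y).re) := by
    refine IsBigO.of_bound 1 ?_
    filter_upwards [eventually_gt_atTop 0] with n hn
    rw [Complex.norm_natCast_cpow_of_pos hn, one_mul]
    exact le_abs_self _
  refine ((h1.isBigO_one ℝ).mul h2).congr' ?_ (by simp)
  filter_upwards [eventually_gt_atTop 0] with n hn
  have hn' : (n : ℂ) ≠ 0 := by exact_mod_cast hn.ne'
  have hfac : (n.factorial : ℂ) ≠ 0 := by exact_mod_cast n.factorial_ne_zero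
  rw [Gamma_add_nat_add_one hx hn, Gamma_add_nat_add_one hy hn, Complex.cpow_sub _ _ hn',
    Pi.div_apply, mul_div_mul_comm, mul_div_mul_right _ _ hfac]

lemma recipGammaPair_nat_add_one {x : ℂ} (hx : ∀ m : ℤ, x ≠ m) (y : ℂ) (n : ℕ) :
    recipGammaPair x y (n + 1) = Complex.sin (Real.pi * (x - (n + 1))) / Real.pi *
      (Complex.Gamma (1 - x + (n + 1)) / Complex.Gamma (y + (n + 1))) := by
  have h := Complex.Gamma_mul_Gamma_one_sub (x - (n + 1))
  have h1 : Complex.Gamma (x - (n + 1)) ≠ 0 :=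
    Gamma_ne_zero_of_ne_int fun m hm ↦ hx (m + n + 1) (by push_cast; linear_combination hm)
  have h2 : Complex.Gamma (1 - (x - (n + 1))) ≠ 0 :=
    Gamma_ne_zero_of_ne_int fun m hm ↦ hx (1 - m + n + 1) (by push_cast; linear_combination -hm)
  have hpi : (Real.pi : ℂ) ≠ 0 := by exact_mod_cast Real.pi_ne_zero
  have hs : Complex.sin (Real.pi * (x - (n + 1))) ≠ 0 := by
    intro h0
    rw [h0, div_zero] at h
    exact mul_ne_zero h1 h2 h
  rw [show 1 - x + ((n : ℂ) + 1) = 1 - (x - (n + 1)) by ring]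
  rw [eq_div_iff hs] at h
  have h3 : (Complex.Gamma (x - (n + 1)))⁻¹ =
      Complex.sin (Real.pi * (x - (n + 1))) / Real.pi * Complex.Gamma (1 - (x - (n + 1))) := by
    refine inv_eq_of_mul_eq_one_left ?_
    rw [← mul_div_right_comm, ← mul_div_right_comm, div_eq_one_iff_eq hpi]
    linear_combination h
  simp only [recipGammaPair]
  push_cast
  rw [h3]
  ring

lemma norm_sin_pi_mul_sub_nat (x : ℂ) (n : ℕ) :
    ‖Complex.sin (Real.pi * (x - n))‖ = ‖Complex.sin (Real.pi * x)‖ := by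
  rw [mul_sub, mul_comm (Real.pi : ℂ) n, Complex.sin_antiperiodic.sub_nat_mul_eq]
  simp

lemma isBigO_recipGammaPair {x y : ℂ} (hx : ∀ m : ℤ, x ≠ m) (hy : ∀ m : ℤ, y ≠ m) :
    (fun n : ℕ ↦ recipGammaPair x y (n + 1))
      =O[atTop] (fun n : ℕ ↦ (n : ℝ) ^ (1 - x - y).re) := by
  have h1 : (fun n : ℕ ↦ Complex.sin (Real.pi * (x - (n + 1))) / Real.pi)
      =O[atTop] (fun _ ↦ (1 : ℝ)) := by
    refine IsBigO.of_bound (‖Complex.sin (Real.pi * x)‖ / ‖(Real.pi : ℂ)‖) (.of_forall fun n ↦ ?_)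
    have := norm_sin_pi_mul_sub_nat x (n + 1)
    push_cast at this
    rw [norm_div, this]
    simp
  have h2 := isBigO_Gamma_div_Gamma (x := 1 - x)
    (fun m hm ↦ hx (1 - m) (by push_cast; linear_combination -hm)) hy
  refine (h1.mul h2).congr (fun n ↦ (recipGammaPair_nat_add_one hx y n).symm) (by simp)

lemma isBigO_recipGammaPair_neg {x y : ℂ} (hx : ∀ m : ℤ, x ≠ m) (hy : ∀ m : ℤ, y ≠ m) :
    (fun n : ℕ ↦ recipGammaPair x y (-(n + 1)))
      =O[atTop] (fun n : ℕ ↦ (n : ℝ) ^ (1 - x - y).re) := by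
  simp_rw [recipGammaPair_neg]
  rw [sub_right_comm]
  exact isBigO_recipGammaPair hy hx

lemma summable_int_of_isBigO {f : ℤ → ℂ} {p : ℝ} (hp : p < -1)
    (h1 : (fun n : ℕ ↦ f (n + 1)) =O[atTop] (fun n : ℕ ↦ (n : ℝ) ^ p))
    (h2 : (fun n : ℕ ↦ f (-(n + 1))) =O[atTop] (fun n : ℕ ↦ (n : ℝ) ^ p)) : Summable f := by
  have hs := Real.summable_nat_rpow.2 hp
  have s1 : Summable fun n : ℕ ↦ f n :=
    (summable_nat_add_iff 1).1 (by simpa using summable_of_isBigO_nat hs h1)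
  exact (s1.hasSum.of_nat_of_neg_add_one (summable_of_isBigO_nat hs h2).hasSum).summable

lemma summable_recipGammaPair {x y : ℂ} (hx : ∀ m : ℤ, x ≠ m) (hy : ∀ m : ℤ, y ≠ m)
    (h : 2 < (x + y).re) : Summable (recipGammaPair x y) := by
  refine summable_int_of_isBigO ?_ (isBigO_recipGammaPair hx hy) (isBigO_recipGammaPair_neg hx hy)
  simp at h ⊢
  linarith

lemma isBigO_mul_rpow {f g : ℕ → ℂ} {p q : ℝ}
    (hf : f =O[atTop] (fun n : ℕ ↦ (n : ℝ) ^ p)) (hg : g =O[atTop] (fun n : ℕ ↦ (n : ℝ) ^ q)) :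
    (fun n ↦ f n * g n) =O[atTop] (fun n : ℕ ↦ (n : ℝ) ^ (p + q)) := by
  refine (hf.mul hg).congr' .rfl ?_
  filter_upwards [eventually_gt_atTop 0] with n hn
  rw [Real.rpow_add (by exact_mod_cast hn)]

lemma tendsto_zero_of_isBigO_rpow {f : ℕ → ℂ} {p : ℝ} (hp : p < 0)
    (hf : f =O[atTop] (fun n : ℕ ↦ (n : ℝ) ^ p)) : Tendsto f atTop (𝓝 0) := by
  refine hf.trans_tendsto ?_
  have := (tendsto_rpow_neg_atTop (neg_pos.2 hp)).comp (tendsto_natCast_atTop_atTop (R := ℝ))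
  simpa [Function.comp_def] using this

lemma W_eq (u u' v v' : ℂ) (l : ℤ) : W u u' v v' l =
    recipGammaPair (u + 1) (v + 1) l * recipGammaPair (u' + 1) (v' + 1) l := by
  simp only [W, recipGammaPair, one_div, mul_inv]
  ring

lemma add_ne_int {x : ℂ} (hx : ∀ m : ℤ, x ≠ m) (k : ℤ) (m : ℤ) : x + k ≠ m :=
  fun h ↦ hx (m - k) (by push_cast; linear_combination h)

lemma add_one_ne_int {x : ℂ} (hx : ∀ m : ℤ, x ≠ m) (m : ℤ) : x + 1 ≠ m := by
  simpa using add_ne_int hx 1 m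

lemma summable_W {u u' v v' : ℂ} (hu : ∀ m : ℤ, u ≠ m) (hu' : ∀ m : ℤ, u' ≠ m)
    (hv : ∀ m : ℤ, v ≠ m) (hv' : ∀ m : ℤ, v' ≠ m) (h : -1 < (u + u' + v + v').re) :
    Summable (W u u' v v') := by
  have a := add_one_ne_int hu
  have a' := add_one_ne_int hu'
  have b := add_one_ne_int hv
  have b' := add_one_ne_int hv'
  simp only [funext (W_eq u u' v v')]
  refine summable_int_of_isBigO ?_
    (isBigO_mul_rpow (isBigO_recipGammaPair a b) (isBigO_recipGammaPair a' b'))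
    (isBigO_mul_rpow (isBigO_recipGammaPair_neg a b) (isBigO_recipGammaPair_neg a' b'))
  simp at h ⊢
  linarith

lemma tsum_sub_shift_eq_zero {G : ℤ → ℂ} (hs : Summable fun l ↦ G (l + 1) - G l)
    (h1 : Tendsto (fun n : ℕ ↦ G (n + 1)) atTop (𝓝 0))
    (h2 : Tendsto (fun n : ℕ ↦ G (-(n + 1))) atTop (𝓝 0)) : ∑' l, (G (l + 1) - G l) = 0 := by
  have h1' : Tendsto (fun n : ℕ ↦ G n) atTop (𝓝 0) :=
    (tendsto_add_atTop_iff_nat 1).1 (by simpa using h1)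
  have h2' : Tendsto (fun n : ℕ ↦ G (-n)) atTop (𝓝 0) :=
    (tendsto_add_atTop_iff_nat 1).1 (by simpa using h2)
  have p1 : ∀ n, ∑ i ∈ Finset.range n, (G ((i : ℤ) + 1) - G i) = G n - G 0 := fun n ↦ by
    have := Finset.sum_range_sub (fun n : ℕ ↦ G n) n
    push_cast at this
    exact this
  have p2 : ∀ n, ∑ i ∈ Finset.range n, (G (-((i : ℤ) + 1) + 1) - G (-((i : ℤ) + 1)))
      = G 0 - G (-n) := fun n ↦ by
    have := Finset.sum_range_sub' (fun n : ℕ ↦ G (-n)) n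
    push_cast at this
    rw [neg_zero] at this
    rw [← this]
    exact Finset.sum_congr rfl fun i _ ↦ by rw [show -((i : ℤ) + 1) + 1 = -i by ring]
  have c1 : Summable fun n : ℕ ↦ G ((n : ℤ) + 1) - G n :=
    hs.comp_injective Nat.cast_injective
  have c2 : Summable fun n : ℕ ↦ G (-((n : ℤ) + 1) + 1) - G (-((n : ℤ) + 1)) :=
    hs.comp_injective (i := fun n : ℕ ↦ -((n : ℤ) + 1)) fun a b hab ↦ by
      simpa only [neg_inj, add_left_inj, Nat.cast_inj] using hab
  have s1 : HasSum (fun n : ℕ ↦ G ((n : ℤ) + 1) - G n) (0 - G 0) := by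
    rw [c1.hasSum_iff_tendsto_nat]
    simp only [p1]
    exact h1'.sub_const (G 0)
  have s2 : HasSum (fun n : ℕ ↦ G (-((n : ℤ) + 1) + 1) - G (-((n : ℤ) + 1))) (G 0 - 0) := by
    rw [c2.hasSum_iff_tendsto_nat]
    simp only [p2]
    exact h2'.const_sub (G 0)
  rw [(HasSum.of_nat_of_neg_add_one (f := fun l ↦ G (l + 1) - G l) s1 s2).tsum_eq]
  ring

lemma W_contiguous (u u' v v' : ℂ) (l : ℤ) :
    (u + u' + v + v' + 1) * W u u' v v' l
        - (u + v + 1) * (u + v' + 1) * W (u + 1) u' v v' l =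
      recipGammaPair (u + 2) v (l + 1) * recipGammaPair (u' + 1) v' (l + 1) -
        recipGammaPair (u + 2) v l * recipGammaPair (u' + 1) v' l := by
  have e1 := Complex.one_div_Gamma_eq_self_mul_one_div_Gamma_add_one (u + 1 - l)
  have e2 := Complex.one_div_Gamma_eq_self_mul_one_div_Gamma_add_one (u' - l)
  have e3 := Complex.one_div_Gamma_eq_self_mul_one_div_Gamma_add_one (v + l)
  have e4 := Complex.one_div_Gamma_eq_self_mul_one_div_Gamma_add_one (v' + l)
  simp only [W_eq, recipGammaPair]
  push_cast
  rw [show u + 2 - (l + 1 : ℂ) = u + 1 - l by ring, show u' + 1 - (l + 1 : ℂ) = u' - l by ring,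
    show v + (l + 1 : ℂ) = v + l + 1 by ring, show v' + (l + 1 : ℂ) = v' + l + 1 by ring,
    show u + 1 + 1 - (l : ℂ) = u + 1 - l + 1 by ring, show u + 2 - (l : ℂ) = u + 1 - l + 1 by ring,
    show v + 1 + (l : ℂ) = v + l + 1 by ring, show v' + 1 + (l : ℂ) = v' + l + 1 by ring,
    show u' + 1 - (l : ℂ) = u' - l + 1 by ring, e1, e2, e3, e4]
  ring

/-- The right-hand side of Dougall's identity. -/
noncomputable def dougallValue (u u' v v' : ℂ) : ℂ :=
  Complex.Gamma (u + u' + v + v' + 1) /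
    (Complex.Gamma (u + v + 1) * Complex.Gamma (u + v' + 1) *
      Complex.Gamma (u' + v + 1) * Complex.Gamma (u' + v' + 1))

lemma tsum_W_of_add_one {u u' v v' : ℂ} (hu : ∀ m : ℤ, u ≠ m) (hu' : ∀ m : ℤ, u' ≠ m)
    (hv : ∀ m : ℤ, v ≠ m) (hv' : ∀ m : ℤ, v' ≠ m) (h : -1 < (u + u' + v + v').re)
    (ih : ∑' l, W (u + 1) u' v v' l = dougallValue (u + 1) u' v v') :
    ∑' l, W u u' v v' l = dougallValue u u' v v' := by
  have a : ∀ m : ℤ, u + 2 ≠ m := by simpa using add_ne_int hu 2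
  have a' := add_one_ne_int hu'
  have w0 := summable_W hu hu' hv hv' h
  have w1 := summable_W (add_one_ne_int hu) hu' hv hv' (by simp at h ⊢; linarith)
  have hd := (w0.mul_left (u + u' + v + v' + 1)).sub (w1.mul_left ((u + v + 1) * (u + v' + 1)))
  have hz : ∑' l, ((u + u' + v + v' + 1) * W u u' v v' l
      - (u + v + 1) * (u + v' + 1) * W (u + 1) u' v v' l) = 0 := by
    simp only [W_contiguous] at hd ⊢
    refine tsum_sub_shift_eq_zero
      (G := fun l ↦ recipGammaPair (u + 2) v l * recipGammaPair (u' + 1) v' l) hd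
      (tendsto_zero_of_isBigO_rpow ?_
        (isBigO_mul_rpow (isBigO_recipGammaPair a hv) (isBigO_recipGammaPair a' hv')))
      (tendsto_zero_of_isBigO_rpow ?_
        (isBigO_mul_rpow (isBigO_recipGammaPair_neg a hv) (isBigO_recipGammaPair_neg a' hv')))
    all_goals
      simp at h ⊢
      linarith
  rw [(w0.mul_left _).tsum_sub (w1.mul_left _), tsum_mul_left, tsum_mul_left, ih] at hz
  have hs : u + u' + v + v' + 1 ≠ 0 := by
    intro h0
    have := congrArg Complex.re h0
    simp at this h
    linarith
  have g := Complex.Gamma_add_one _ hs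
  have e1 := Complex.one_div_Gamma_eq_self_mul_one_div_Gamma_add_one (u + v + 1)
  have e2 := Complex.one_div_Gamma_eq_self_mul_one_div_Gamma_add_one (u + v' + 1)
  refine mul_left_cancel₀ hs ((sub_eq_zero.1 hz).trans ?_)
  simp only [dougallValue, div_eq_mul_inv, mul_inv]
  rw [show u + 1 + u' + v + v' + 1 = u + u' + v + v' + 1 + 1 by ring,
    show u + 1 + v + 1 = u + v + 1 + 1 by ring, show u + 1 + v' + 1 = u + v' + 1 + 1 by ring,
    g, e1, e2]
  ring

open Complex MeasureTheory Set in
lemma continuousOn_one_add_cpow {s : ℂ} (hs : 0 < s.re) :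
    ContinuousOn (fun z : ℂ ↦ (1 + z) ^ s) (Metric.closedBall 0 1) := by
  intro z hz
  have hz' : 0 ≤ (1 + z).re := by
    have h1 : ‖z‖ ≤ 1 := by simpa using hz
    have h2 := (abs_le.1 ((abs_re_le_norm z).trans h1)).1
    simp only [add_re, one_re]
    linarith
  exact (ContinuousAt.comp (f := fun z : ℂ ↦ 1 + z)
    (continuousAt_cpow_const_of_re_pos (.inl hz') hs) (by fun_prop)).continuousWithinAt

/-- The function `(1 + e^{it})^s e^{-ibt}`, equal to `(1 + e^{it})^{s-b} (1 + e^{-it})^b`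
on `(-π, π)`. -/
noncomputable def circlePow (s b : ℂ) (t : ℝ) : ℂ :=
  (1 + Complex.exp (t * Complex.I)) ^ s * Complex.exp (-(b * t * Complex.I))

lemma continuous_circlePow_base {s : ℂ} (hs : 0 < s.re) :
    Continuous fun t : ℝ ↦ (1 + Complex.exp (t * Complex.I)) ^ s :=
  (continuousOn_one_add_cpow hs).comp_continuous (f := fun t : ℝ ↦ Complex.exp (t * Complex.I))
    (by fun_prop) fun t ↦ by simp [Complex.norm_exp_ofReal_mul_I]

lemma continuous_circlePow {s : ℂ} (hs : 0 < s.re) (b : ℂ) : Continuous (circlePow s b) :=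
  (continuous_circlePow_base hs).mul (by fun_prop)

lemma differentiable_integral_circlePow {s : ℂ} (hs : 0 < s.re) :
    Differentiable ℂ fun b ↦ ∫ t in (-Real.pi)..Real.pi, circlePow s b t := by
  intro b₀
  have hc := continuous_circlePow_base hs
  obtain ⟨M, hM⟩ := (isCompact_Icc (a := -Real.pi) (b := Real.pi)).exists_bound_of_continuousOn
    hc.continuousOn
  have hpi := Real.pi_pos
  refine (intervalIntegral.hasDerivAt_integral_of_dominated_loc_of_deriv_le
    (F' := fun b t ↦ (1 + Complex.exp (t * Complex.I)) ^ s *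
      (Complex.exp (-(b * t * Complex.I)) * (-(t * Complex.I))))
    (bound := fun _ ↦ M * (Real.exp ((‖b₀‖ + 1) * Real.pi) * Real.pi))
    (Metric.ball_mem_nhds b₀ one_pos)
    (.of_forall fun b ↦ (continuous_circlePow hs b).aestronglyMeasurable)
    ((continuous_circlePow hs b₀).intervalIntegrable _ _)
    (Continuous.aestronglyMeasurable (hc.mul (by fun_prop)))
    (.of_forall fun t ht b hb ↦ ?_) intervalIntegrable_const
    (.of_forall fun t ht b hb ↦ ?_)).2.differentiableAt
  · rw [Set.uIoc_of_le (by linarith)] at ht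
    have ht' : |t| ≤ Real.pi := abs_le.2 ⟨ht.1.le, ht.2⟩
    have hb' : ‖b‖ ≤ ‖b₀‖ + 1 := by
      have h1 := norm_add_le (b - b₀) b₀
      rw [sub_add_cancel] at h1
      have h2 : ‖b - b₀‖ < 1 := by simpa [dist_eq_norm] using hb
      linarith
    have hM0 : 0 ≤ M := (norm_nonneg _).trans (hM t ⟨ht.1.le, ht.2⟩)
    rw [norm_mul, norm_mul]
    gcongr
    · exact hM t ⟨ht.1.le, ht.2⟩
    · refine (Complex.norm_exp_le_exp_norm _).trans (Real.exp_le_exp.2 ?_)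
      rw [norm_neg, norm_mul, norm_mul, Complex.norm_I, mul_one, Complex.norm_real]
      exact mul_le_mul hb' ht' (abs_nonneg t) (by positivity)
    · simpa using ht'
  · have h1 : HasDerivAt (fun b : ℂ ↦ -(b * t * Complex.I)) (-(t * Complex.I)) b := by
      simpa using (((hasDerivAt_id b).mul_const (t : ℂ)).mul_const Complex.I).fun_neg
    exact h1.cexp.const_mul _

/-- The function `(1 + e^w)^s e^{-bw}` on the strip `|Im w| ≤ π`, `Re w ≤ 0`. -/
noncomputable def stripPow (s b w : ℂ) : ℂ := (1 + Complex.exp w) ^ s * Complex.exp (-(b * w))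

lemma stripPow_rect {s : ℂ} (hs : 0 < s.re) (b : ℂ) {R : ℝ} (hR : 0 < R) :
    (∫ x in (-R)..0, stripPow s b (x - Real.pi * Complex.I)) -
      (∫ x in (-R)..0, stripPow s b (x + Real.pi * Complex.I)) +
      Complex.I * (∫ y in (-Real.pi)..Real.pi, circlePow s b y) -
      Complex.I * (∫ y in (-Real.pi)..Real.pi, stripPow s b (-R + y * Complex.I)) = 0 := by
  have hpi := Real.pi_pos
  have h := Complex.integral_boundary_rect_eq_zero_of_continuousOn_of_differentiableOn
    (stripPow s b) (-R - Real.pi * Complex.I) (Real.pi * Complex.I) ?_ ?_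
  · simpa [stripPow, circlePow, sub_eq_add_neg, mul_assoc] using h
  · refine ContinuousOn.mul ?_ (by fun_prop)
    refine (continuousOn_one_add_cpow hs).comp Complex.continuous_exp.continuousOn ?_
    intro w hw
    have h1 := hw.1
    simp only [Set.mem_preimage] at h1
    rw [Set.uIcc_of_le (by simp; linarith)] at h1
    have h2 := h1.2
    simp at h2
    simpa [Complex.norm_exp] using h2
  · intro w hw
    have h1 := hw.1
    have h2 := hw.2
    simp only [Set.mem_preimage] at h1 h2
    rw [min_eq_left (by simp; linarith), max_eq_right (by simp; linarith)] at h1 h2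
    have h3 := h1.2
    simp at h3 h2
    refine (DifferentiableAt.mul ?_ (by fun_prop)).differentiableWithinAt
    refine DifferentiableAt.cpow_const (by fun_prop) ?_
    refine Or.inl ?_
    have h4 := Complex.abs_re_le_norm (Complex.exp w)
    rw [Complex.norm_exp] at h4
    have h5 := (abs_le.1 h4).1
    have h6 := Real.exp_lt_one_iff.2 h3
    simp only [Complex.add_re, Complex.one_re]
    linarith

lemma stripPow_left_tendsto {s : ℂ} (hs : 0 < s.re) {b : ℂ} (hb : b.re < 0) :
    Tendsto (fun R : ℝ ↦ ∫ y in (-Real.pi)..Real.pi, stripPow s b (-R + y * Complex.I))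
      atTop (𝓝 0) := by
  have hpi := Real.pi_pos
  obtain ⟨M, hM⟩ := (isCompact_closedBall (0 : ℂ) 1).exists_bound_of_continuousOn
    (continuousOn_one_add_cpow hs)
  have hM0 : 0 ≤ M := (norm_nonneg _).trans (hM 0 (by simp))
  have hlim : Tendsto (fun R : ℝ ↦
      M * (Real.exp (b.re * R) * Real.exp (|b.im| * Real.pi)) * |Real.pi - -Real.pi|)
      atTop (𝓝 0) := by
    have h1 : Tendsto (fun R : ℝ ↦ Real.exp (b.re * R)) atTop (𝓝 0) :=
      Real.tendsto_exp_atBot.comp (tendsto_id.const_mul_atTop_of_neg hb)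
    simpa using ((h1.mul_const (Real.exp (|b.im| * Real.pi))).const_mul M).mul_const
      |Real.pi - -Real.pi|
  refine squeeze_zero_norm' ?_ hlim
  filter_upwards [eventually_ge_atTop 0] with R hR
  refine intervalIntegral.norm_integral_le_of_norm_le_const fun y hy ↦ ?_
  rw [Set.uIoc_of_le (by linarith)] at hy
  have hy' : |y| ≤ Real.pi := abs_le.2 ⟨hy.1.le, hy.2⟩
  rw [stripPow, norm_mul]
  gcongr
  · exact hM _ (by simpa [Complex.norm_exp] using hR)
  · rw [Complex.norm_exp, ← Real.exp_add]
    refine Real.exp_le_exp.2 ?_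
    have : (-(b * (-R + y * Complex.I))).re = b.re * R + b.im * y := by simp; ring
    rw [this]
    have h1 : b.im * y ≤ |b.im| * |y| := by rw [← abs_mul]; exact le_abs_self _
    have h2 := mul_le_mul_of_nonneg_left hy' (abs_nonneg b.im)
    linarith

lemma integral_one_sub_exp_cpow {s : ℂ} (hs : 0 < s.re) {b : ℂ} {R : ℝ} (hR : 0 < R) :
    ∫ x in (-R)..0, (1 - (Real.exp x : ℂ)) ^ s * Complex.exp (-(b * x)) =
      ∫ y in (Real.exp (-R))..1, (y : ℂ) ^ (-b - 1) * (1 - y) ^ (s + 1 - 1) := by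
  have h := intervalIntegral.integral_deriv_smul_comp' (a := -R) (b := 0) (f := Real.exp)
    (f' := Real.exp) (g := fun y : ℝ ↦ (y : ℂ) ^ (-b - 1) * (1 - y) ^ (s + 1 - 1))
    (fun x _ ↦ Real.hasDerivAt_exp x) Real.continuous_exp.continuousOn ?_
  · rw [Real.exp_zero] at h
    rw [← h]
    refine intervalIntegral.integral_congr fun x _ ↦ ?_
    have hx : (Real.exp x : ℂ) ≠ 0 := by exact_mod_cast (Real.exp_pos x).ne'
    have hp : (Real.exp x : ℂ) ^ (-b) = Complex.exp (-(b * x)) := by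
      rw [Complex.cpow_def_of_ne_zero hx, ← Complex.ofReal_log (Real.exp_pos x).le, Real.log_exp]
      ring_nf
    simp only [Function.comp_apply, Complex.real_smul, add_sub_cancel_right]
    rw [Complex.cpow_sub _ _ hx, Complex.cpow_one, hp]
    field_simp
  · rintro y ⟨x, hx, rfl⟩
    rw [Set.uIcc_of_le (by linarith)] at hx
    have h1 : (Real.exp x : ℂ) ∈ Complex.slitPlane := by
      rw [Complex.ofReal_mem_slitPlane]
      exact Real.exp_pos x
    have h2 : 0 ≤ (1 - (Real.exp x : ℂ)).re := by
      simpa only [Complex.sub_re, Complex.one_re, Complex.ofReal_re, sub_nonneg,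
        Real.exp_le_one_iff] using hx.2
    refine ContinuousAt.continuousWithinAt (ContinuousAt.mul ?_ ?_)
    · exact ContinuousAt.comp (f := fun y : ℝ ↦ (y : ℂ)) (continuousAt_cpow_const h1)
        Complex.continuous_ofReal.continuousAt
    · exact ContinuousAt.comp (f := fun y : ℝ ↦ 1 - (y : ℂ))
        (Complex.continuousAt_cpow_const_of_re_pos (.inl h2) (by simpa using hs)) (by fun_prop)

lemma tendsto_integral_one_sub_exp_cpow {s : ℂ} (hs : 0 < s.re) {b : ℂ} (hb : b.re < 0) :
    Tendsto (fun R : ℝ ↦ ∫ x in (-R)..0, (1 - (Real.exp x : ℂ)) ^ s * Complex.exp (-(b * x)))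
      atTop (𝓝 (Complex.betaIntegral (-b) (s + 1))) := by
  have hint := Complex.betaIntegral_convergent (u := -b) (v := s + 1) (by simpa using hb)
    (by simp; linarith)
  have hcont := intervalIntegral.continuousOn_primitive_interval_left (a := 0) (b := 1)
    (f := fun y : ℝ ↦ (y : ℂ) ^ (-b - 1) * (1 - y) ^ (s + 1 - 1)) (μ := MeasureTheory.volume)
    ((intervalIntegrable_iff_integrableOn_Icc_of_le (by norm_num)).1 hint |>.mono_set (by simp))
  have h0 := hcont 0 (by simp)
  have hexp : Tendsto (fun R : ℝ ↦ Real.exp (-R)) atTop (𝓝[Set.uIcc 0 1] 0) := by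
    refine tendsto_nhdsWithin_iff.2 ⟨Real.tendsto_exp_neg_atTop_nhds_zero, ?_⟩
    filter_upwards [eventually_ge_atTop 0] with R hR
    rw [Set.uIcc_of_le zero_le_one]
    exact ⟨(Real.exp_pos _).le, Real.exp_le_one_iff.2 (by linarith)⟩
  refine (h0.tendsto.comp hexp).congr' ?_
  filter_upwards [eventually_gt_atTop 0] with R hR
  exact (integral_one_sub_exp_cpow hs hR).symm

lemma stripPow_sub_pi (s b : ℂ) (x : ℝ) : stripPow s b (x - Real.pi * Complex.I) =
    Complex.exp (b * Real.pi * Complex.I) *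
      ((1 - (Real.exp x : ℂ)) ^ s * Complex.exp (-(b * x))) := by
  rw [stripPow, Complex.exp_sub, Complex.exp_pi_mul_I,
    show -(b * (x - Real.pi * Complex.I)) = b * Real.pi * Complex.I + -(b * x) by ring,
    Complex.exp_add]
  push_cast
  ring_nf

lemma stripPow_add_pi (s b : ℂ) (x : ℝ) : stripPow s b (x + Real.pi * Complex.I) =
    Complex.exp (-(b * Real.pi * Complex.I)) *
      ((1 - (Real.exp x : ℂ)) ^ s * Complex.exp (-(b * x))) := by
  rw [stripPow, Complex.exp_add, Complex.exp_pi_mul_I,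
    show -(b * (x + Real.pi * Complex.I)) = -(b * Real.pi * Complex.I) + -(b * x) by ring,
    Complex.exp_add]
  push_cast
  ring_nf

lemma integral_circlePow_of_re_neg {s : ℂ} (hs : 0 < s.re) {b : ℂ} (hb : b.re < 0) :
    ∫ t in (-Real.pi)..Real.pi, circlePow s b t =
      2 * Real.pi * (Complex.Gamma (s + 1) *
        ((Complex.Gamma (b + 1))⁻¹ * (Complex.Gamma (s + 1 - b))⁻¹)) := by
  have hA := tendsto_integral_one_sub_exp_cpow hs hb
  have h1 := (((hA.const_mul (Complex.exp (b * Real.pi * Complex.I))).sub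
    (hA.const_mul (Complex.exp (-(b * Real.pi * Complex.I))))).add_const
    (Complex.I * ∫ t in (-Real.pi)..Real.pi, circlePow s b t)).sub
      ((stripPow_left_tendsto hs hb).const_mul Complex.I)
  have h2 := tendsto_nhds_unique (h1.congr' (f₂ := fun _ ↦ 0) (by
    filter_upwards [eventually_gt_atTop 0] with R hR
    have := stripPow_rect hs b hR
    simpa only [stripPow_sub_pi, stripPow_add_pi, intervalIntegral.integral_const_mul] using this))
    tendsto_const_nhds
  have hpi : (Real.pi : ℂ) ≠ 0 := by exact_mod_cast Real.pi_ne_zero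
  have hsin : Complex.exp (b * Real.pi * Complex.I) - Complex.exp (-(b * Real.pi * Complex.I)) =
      2 * Complex.I * Complex.sin (Real.pi * b) := by
    rw [Complex.sin]
    ring_nf
    simp
    ring
  have hrefl : Complex.Gamma (-b) * -Complex.sin (Real.pi * b) =
      Real.pi * (Complex.Gamma (b + 1))⁻¹ := by
    have h3 := Complex.Gamma_mul_Gamma_one_sub (-b)
    have hG : Complex.Gamma (-b) ≠ 0 := Complex.Gamma_ne_zero_of_re_pos (by simpa using hb)
    rw [sub_neg_eq_add, add_comm 1 b, mul_neg, Complex.sin_neg] at h3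
    by_cases h0 : Complex.sin (Real.pi * b) = 0
    · rw [h0] at h3 ⊢
      have : Complex.Gamma (b + 1) = 0 := by simpa [hG] using h3
      simp [this]
    · have hG1 : Complex.Gamma (b + 1) ≠ 0 := by
        intro h4
        rw [h4, mul_zero, eq_comm, div_eq_zero_iff] at h3
        simp [hpi, h0] at h3
      rw [eq_div_iff (neg_ne_zero.2 h0)] at h3
      rw [eq_mul_inv_iff_mul_eq₀ hG1]
      linear_combination h3
  rw [Complex.betaIntegral_eq_Gamma_mul_div _ _ (by simpa using hb) (by simp; linarith),
    mul_zero, sub_zero, ← sub_mul, hsin, show -b + (s + 1) = s + 1 - b by ring] at h2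
  refine mul_left_cancel₀ Complex.I_ne_zero ?_
  rw [div_eq_mul_inv] at h2
  linear_combination h2 + 2 * Complex.I * Complex.Gamma (s + 1) * (Complex.Gamma (s + 1 - b))⁻¹ * hrefl

lemma integral_circlePow {s : ℂ} (hs : 0 < s.re) (b : ℂ) :
    ∫ t in (-Real.pi)..Real.pi, circlePow s b t =
      2 * Real.pi * (Complex.Gamma (s + 1) *
        ((Complex.Gamma (b + 1))⁻¹ * (Complex.Gamma (s + 1 - b))⁻¹)) := by
  have hd : Differentiable ℂ fun b ↦ 2 * Real.pi * (Complex.Gamma (s + 1) *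
        ((Complex.Gamma (b + 1))⁻¹ * (Complex.Gamma (s + 1 - b))⁻¹)) := by
    refine ((Differentiable.mul ?_ ?_).const_mul _).const_mul _
    · exact Complex.differentiable_one_div_Gamma.comp (differentiable_id.add_const 1)
    · exact Complex.differentiable_one_div_Gamma.comp (differentiable_id.const_sub (s + 1))
  refine congrFun (AnalyticOnNhd.eq_of_eventuallyEq (𝕜 := ℂ) (z₀ := -1)
    (fun z _ ↦ (differentiable_integral_circlePow hs).analyticAt z)
    (fun z _ ↦ hd.analyticAt z) ?_) b
  filter_upwards [(isOpen_lt Complex.continuous_re continuous_const).mem_nhds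
    (show (-1 : ℂ).re < 0 by simp)] with b hb
  exact integral_circlePow_of_re_neg hs hb
section Parseval

open AddCircle MeasureTheory

variable {T : ℝ} [hT : Fact (0 < T)]

lemma hasSum_fourierCoeff_mul_fourierCoeff_neg {f g : C(AddCircle T, ℂ)}
    (hf : Summable (fourierCoeff f)) :
    HasSum (fun l ↦ fourierCoeff f l * fourierCoeff g (-l))
      (fourierCoeff (fun x ↦ f x * g x) 0) := by
  have h1 := (hasSum_fourier_series_of_summable hf).mul_right g
  have hint (F : C(AddCircle T, ℂ)) : Integrable F haarAddCircle :=
    F.continuous.integrable_of_hasCompactSupport (.of_compactSpace _)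
  have hcont : Continuous fun F : C(AddCircle T, ℂ) ↦ ∫ x, F x ∂haarAddCircle := by
    refine LipschitzWith.continuous (K := 1) (LipschitzWith.of_dist_le_mul fun F G ↦ ?_)
    rw [dist_eq_norm, dist_eq_norm, ← integral_sub (hint F) (hint G)]
    simpa using norm_integral_le_of_norm_le_const (μ := haarAddCircle) (C := ‖F - G‖)
      (.of_forall fun x ↦ (F - G).norm_coe_le_norm x)
  have h2 := h1.map (AddMonoidHom.mk' (fun F : C(AddCircle T, ℂ) ↦ ∫ x, F x ∂haarAddCircle)
    fun F G ↦ integral_add (hint F) (hint G)) hcont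
  convert! h2 using 1
  · ext l
    simp [fourierCoeff, integral_const_mul]
  · simp [fourierCoeff]

end Parseval

lemma circlePow_pi {s : ℂ} (hs : s ≠ 0) (b : ℂ) : circlePow s b Real.pi = 0 := by
  simp [circlePow, Complex.exp_pi_mul_I, hs]

lemma circlePow_neg_pi {s : ℂ} (hs : s ≠ 0) (b : ℂ) : circlePow s b (-Real.pi) = 0 := by
  simp [circlePow, Complex.exp_neg, Complex.exp_pi_mul_I, hs]

lemma circlePow_mul {s s' : ℂ} (hs : 0 < s.re) (hs' : 0 < s'.re) (b b' : ℂ) (t : ℝ) :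
    circlePow s b t * circlePow s' b' t = circlePow (s + s') (b + b') t := by
  have hne : ∀ {z : ℂ}, 0 < z.re → z ≠ 0 := by
    rintro z hz rfl
    simp at hz
  have hexp : Complex.exp (-((b + b') * t * Complex.I)) =
      Complex.exp (-(b * t * Complex.I)) * Complex.exp (-(b' * t * Complex.I)) := by
    rw [← Complex.exp_add]
    ring_nf
  have hpow : (1 + Complex.exp (t * Complex.I)) ^ (s + s') =
      (1 + Complex.exp (t * Complex.I)) ^ s * (1 + Complex.exp (t * Complex.I)) ^ s' := by
    by_cases h : 1 + Complex.exp (t * Complex.I) = 0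
    · rw [h, Complex.zero_cpow (hne hs), Complex.zero_cpow (hne (z := s + s') (by simp; linarith)),
        zero_mul]
    · exact Complex.cpow_add _ _ h
  simp only [circlePow, hexp, hpow]
  ring

section Coefficients

local instance : Fact (0 < 2 * Real.pi) := ⟨Real.two_pi_pos⟩

/-- The function on the circle `ℝ / 2πℤ` that agrees with `circlePow s b` on `[-π, π]`. -/
noncomputable def circlePowLift (s b : ℂ) : AddCircle (2 * Real.pi) → ℂ :=
  AddCircle.liftIoc (2 * Real.pi) (-Real.pi) (circlePow s b)

lemma continuous_circlePowLift {s : ℂ} (hs : 0 < s.re) (b : ℂ) :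
    Continuous (circlePowLift s b) := by
  have h0 : s ≠ 0 := by
    rintro rfl
    simp at hs
  refine AddCircle.liftIoc_continuous ?_ (continuous_circlePow hs b).continuousOn
  rw [show -Real.pi + 2 * Real.pi = Real.pi by ring, circlePow_pi h0, circlePow_neg_pi h0]

lemma circlePowLift_mul {s s' : ℂ} (hs : 0 < s.re) (hs' : 0 < s'.re) (b b' : ℂ)
    (x : AddCircle (2 * Real.pi)) :
    circlePowLift s b x * circlePowLift s' b' x = circlePowLift (s + s') (b + b') x :=
  circlePow_mul hs hs' b b' _

lemma fourierCoeff_circlePowLift {s : ℂ} (hs : 0 < s.re) (b : ℂ) (l : ℤ) :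
    fourierCoeff (circlePowLift s b) l =
      Complex.Gamma (s + 1) * recipGammaPair (s - b + 1) (b + 1) l := by
  have hpi : (Real.pi : ℂ) ≠ 0 := by exact_mod_cast Real.pi_ne_zero
  have h : ∀ t : ℝ, fourier (-l) (t : AddCircle (2 * Real.pi)) • circlePow s b t =
      circlePow s (b + l) t := by
    intro t
    rw [fourier_coe_apply, smul_eq_mul, circlePow, circlePow, mul_left_comm, ← Complex.exp_add]
    congr 2
    push_cast
    field_simp
    ring
  rw [circlePowLift, fourierCoeff_liftIoc_eq, fourierCoeffOn_eq_integral,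
    add_sub_cancel_left (-Real.pi)]
  simp only [h]
  rw [show -Real.pi + 2 * Real.pi = Real.pi by ring, integral_circlePow hs, recipGammaPair,
    show s + 1 - (b + l) = s - b + 1 - l by ring, show b + l + 1 = b + 1 + l by ring,
    Complex.real_smul]
  push_cast
  field_simp

lemma tsum_W_of_re_pos {u u' v v' : ℂ} (hu : ∀ m : ℤ, u ≠ m) (hv : ∀ m : ℤ, v ≠ m)
    (h : 0 < (u + v).re) (h' : 0 < (u' + v').re) :
    ∑' l, W u u' v v' l = dougallValue u u' v v' := by
  have hc := fourierCoeff_circlePowLift h v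
  have hc' := fourierCoeff_circlePowLift h' u'
  have hsum : Summable (fourierCoeff (circlePowLift (u + v) v)) := by
    rw [funext hc]
    refine (summable_recipGammaPair (x := u + v - v + 1) ?_ (add_one_ne_int hv) ?_).mul_left _
    · simpa using add_one_ne_int hu
    · simp at h ⊢
      linarith
  have key := hasSum_fourierCoeff_mul_fourierCoeff_neg
    (f := ⟨_, continuous_circlePowLift h v⟩) (g := ⟨_, continuous_circlePowLift h' u'⟩) hsum
  simp only [ContinuousMap.coe_mk, circlePowLift_mul h h', hc, hc', recipGammaPair_neg] at key
  rw [fourierCoeff_circlePowLift (by simp at h h' ⊢; linarith)] at key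
  have hG : Complex.Gamma (u + v + 1) ≠ 0 :=
    Complex.Gamma_ne_zero_of_re_pos (by simp at h ⊢; linarith)
  have hG' : Complex.Gamma (u' + v' + 1) ≠ 0 :=
    Complex.Gamma_ne_zero_of_re_pos (by simp at h' ⊢; linarith)
  have hW : ∀ l, W u u' v v' l = (Complex.Gamma (u + v + 1) * Complex.Gamma (u' + v' + 1))⁻¹ *
      (Complex.Gamma (u + v + 1) * recipGammaPair (u + v - v + 1) (v + 1) l *
        (Complex.Gamma (u' + v' + 1) * recipGammaPair (u' + 1) (u' + v' - u' + 1) l)) := by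
    intro l
    rw [W_eq, add_sub_cancel_right, add_sub_cancel_left]
    field_simp
  rw [tsum_congr hW, tsum_mul_left, key.tsum_eq, dougallValue, recipGammaPair,
    show u + v + (u' + v') + 1 = u + u' + v + v' + 1 by ring,
    show u + v + (u' + v') - (v + u') + 1 - ((0 : ℤ) : ℂ) = u + v' + 1 by push_cast; ring,
    show v + u' + 1 + ((0 : ℤ) : ℂ) = u' + v + 1 by push_cast; ring]
  simp only [div_eq_mul_inv, mul_inv]
  ring

end Coefficients

lemma tsum_W_of_add_nat {u u' v v' : ℂ} (hu : ∀ m : ℤ, u ≠ m) (hu' : ∀ m : ℤ, u' ≠ m)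
    (hv : ∀ m : ℤ, v ≠ m) (hv' : ∀ m : ℤ, v' ≠ m) (h : -1 < (u + u' + v + v').re) (n : ℕ)
    (ih : ∑' l, W (u + n) u' v v' l = dougallValue (u + n) u' v v') :
    ∑' l, W u u' v v' l = dougallValue u u' v v' := by
  induction n with
  | zero => simpa using ih
  | succ n hn =>
    refine hn (tsum_W_of_add_one (by simpa using add_ne_int hu n) hu' hv hv' ?_ ?_)
    · simp at h ⊢
      linarith [n.cast_nonneg (α := ℝ)]
    · push_cast at ih
      rwa [← add_assoc] at ih

lemma W_swap (u u' v v' : ℂ) (l : ℤ) : W u u' v v' l = W u' u v' v l := by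
  rw [W_eq, W_eq, mul_comm]

lemma dougallValue_swap (u u' v v' : ℂ) : dougallValue u u' v v' = dougallValue u' u v' v := by
  rw [dougallValue, dougallValue, show u + u' + v + v' = u' + u + v' + v by ring]
  ring

lemma tsum_W {u u' v v' : ℂ} (hu : ∀ m : ℤ, u ≠ m) (hu' : ∀ m : ℤ, u' ≠ m)
    (hv : ∀ m : ℤ, v ≠ m) (hv' : ∀ m : ℤ, v' ≠ m) (h : -1 < (u + u' + v + v').re) :
    ∑' l, W u u' v v' l = dougallValue u u' v v' := by
  obtain ⟨n, hn⟩ := exists_nat_gt (-(u + v).re)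
  obtain ⟨k, hk⟩ := exists_nat_gt (-(u' + v').re)
  have hun : ∀ m : ℤ, u + n ≠ m := by simpa using add_ne_int hu n
  refine tsum_W_of_add_nat hu hu' hv hv' h n ?_
  simp only [W_swap (u + n), dougallValue_swap (u + n)]
  refine tsum_W_of_add_nat hu' hun hv' hv ?_ k ?_
  · simp at h ⊢
    linarith [n.cast_nonneg (α := ℝ)]
  · refine tsum_W_of_re_pos (by simpa using add_ne_int hu' k) hv' ?_ ?_
    · simp at hk ⊢
      linarith
    · simp at hn ⊢
      linarith

lemma ne_int_of_admissible {u u' : ℂ} (h : Admissible u u') :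
    (∀ m : ℤ, u ≠ m) ∧ ∀ m : ℤ, u' ≠ m := by
  refine ⟨fun m hm ↦ ?_, fun m hm ↦ ?_⟩ <;> simpa [hm] using (h m).2

end Dougall

/-- Dougall's bilateral series identity: if `(u,u')` and `(v,v')` are admissible and
`u + u' + v + v' > -1`, then `(W l)_{l ∈ ℤ}` is summable with sum
`Γ(u+u'+v+v'+1) / (Γ(u+v+1) Γ(u+v'+1) Γ(u'+v+1) Γ(u'+v'+1))`. -/
theorem dougall_bilateral (u u' v v' : ℂ)
    (hu : Admissible u u') (hv : Admissible v v')
    (h : -1 < (u + u' + v + v').re) :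
    Summable (W u u' v v') ∧
      ∑' l : ℤ, W u u' v v' l =
        Complex.Gamma (u + u' + v + v' + 1) /
          (Complex.Gamma (u + v + 1) * Complex.Gamma (u + v' + 1) *
           Complex.Gamma (u' + v + 1) * Complex.Gamma (u' + v' + 1)) := by
  obtain ⟨hu, hu'⟩ := Dougall.ne_int_of_admissible hu
  obtain ⟨hv, hv'⟩ := Dougall.ne_int_of_admissible hv
  exact ⟨Dougall.summable_W hu hu' hv hv' h, Dougall.tsum_W hu hu' hv hv' h⟩
end

section
/- Let (u,u') and (v,v') be admissible couples. Then the family of positive real numbers (W(l))_{l∈ℤ} is summable if and only if u+u'+v+v' > −1. (Equivalently: the symmetrizing measure of the one-particle chain is finite exactly when u+u'+v+v' > −1.) -/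
open Filter Topology Asymptotics
open scoped ComplexOrder

namespace Admissible

variable {u u' : ℂ}

theorem mul_sub_pos (h : Admissible u u') (l : ℤ) : 0 < (u - l) * (u' - l) :=
  Complex.pos_iff.2 ⟨(h l).2, (h l).1.symm⟩

theorem mul_add_pos (h : Admissible u u') (l : ℤ) : 0 < (u + l) * (u' + l) := by
  simpa using h.mul_sub_pos (-l)

theorem sub_ne_zero (h : Admissible u u') (l : ℤ) : u - l ≠ 0 :=
  left_ne_zero_of_mul (h.mul_sub_pos l).ne'

theorem symm (h : Admissible u u') : Admissible u' u := fun l => by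
  simpa only [mul_comm] using h l

theorem add_intCast (h : Admissible u u') (k : ℤ) : Admissible (u + k) (u' + k) := fun l => by
  have := h (l - k)
  push_cast at this
  simpa only [sub_sub_eq_add_sub] using this

theorem im_add (h : Admissible u u') : (u + u').im = 0 := by
  have h0 := (h 0).1
  have h1 := (h 1).1
  simp at h0 h1 ⊢
  linarith

theorem ne_neg_natCast (h : Admissible u u') (m : ℕ) : u ≠ -m := fun hm =>
  h.sub_ne_zero (-m) (by simp [hm])

theorem gammaSeq_mul_nonneg (h : Admissible u u') {n : ℕ} (hn : n ≠ 0) :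
    0 ≤ Complex.GammaSeq u n * Complex.GammaSeq u' n := by
  have hpow : (n : ℂ) ^ u * (n : ℂ) ^ u' = (((n : ℝ) ^ (u + u').re : ℝ) : ℂ) := by
    rw [← Complex.cpow_add _ _ (Nat.cast_ne_zero.2 hn), Complex.ofReal_cpow n.cast_nonneg,
      Complex.ofReal_natCast]
    congr 1
    exact Complex.ext rfl (by simpa using h.im_add)
  have hprod : 0 ≤ ∏ j ∈ Finset.range (n + 1), (u + j) * (u' + j) :=
    Finset.prod_nonneg fun j _ => by simpa using (h.mul_add_pos j).le
  have heq : Complex.GammaSeq u n * Complex.GammaSeq u' n =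
      ((((n : ℝ) ^ (u + u').re * n.factorial ^ 2 : ℝ)) : ℂ) *
        (∏ j ∈ Finset.range (n + 1), (u + j) * (u' + j))⁻¹ := by
    rw [Complex.GammaSeq, Complex.GammaSeq, Finset.prod_mul_distrib, Complex.ofReal_mul, ← hpow]
    push_cast
    rw [div_mul_div_comm, div_eq_mul_inv]
    ring
  rw [heq]
  refine mul_nonneg (Complex.zero_le_real.2 (by positivity)) ?_
  exact inv_nonneg.2 hprod

theorem gamma_mul_nonneg (h : Admissible u u') :
    0 ≤ Complex.Gamma u * Complex.Gamma u' :=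
  ge_of_tendsto ((Complex.GammaSeq_tendsto_Gamma u).mul (Complex.GammaSeq_tendsto_Gamma u'))
    ((eventually_ne_atTop 0).mono fun _ hn => h.gammaSeq_mul_nonneg hn)

end Admissible

variable {u u' v v' : ℂ}

theorem W_neg (u u' v v' : ℂ) (l : ℤ) : W u u' v v' (-l) = W v v' u u' l := by
  simp only [W, Int.cast_neg, sub_neg_eq_add, ← sub_eq_add_neg]
  congr 1
  ring

theorem W_nonneg (hu : Admissible u u') (hv : Admissible v v') (l : ℤ) :
    0 ≤ W u u' v v' l := by
  have h1 := (hu.add_intCast (1 - l)).gamma_mul_nonneg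
  have h2 := (hv.add_intCast (1 + l)).gamma_mul_nonneg
  push_cast at h1 h2
  simp only [← add_sub_assoc, ← add_assoc] at h1 h2
  rw [W, mul_assoc, one_div]
  exact inv_nonneg.2 (by simpa only [mul_assoc] using mul_nonneg h1 h2)

theorem W_ne_zero (hu : Admissible u u') (hv : Admissible v v') (l : ℤ) :
    W u u' v v' l ≠ 0 := by
  have key : ∀ {a a' : ℂ}, Admissible a a' → ∀ k : ℤ, Complex.Gamma (a + k) ≠ 0 :=
    fun h k => Complex.Gamma_ne_zero (h.add_intCast k).ne_neg_natCast
  have h1 := key hu (1 - l)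
  have h2 := key hu.symm (1 - l)
  have h3 := key hv (1 + l)
  have h4 := key hv.symm (1 + l)
  push_cast at h1 h2 h3 h4
  simp only [← add_sub_assoc, ← add_assoc] at h1 h2 h3 h4
  rw [W]
  exact one_div_ne_zero (mul_ne_zero (mul_ne_zero (mul_ne_zero h1 h2) h3) h4)

theorem W_add_one_mul (hu : Admissible u u') (hv : Admissible v v') (l : ℤ) :
    W u u' v v' (l + 1) * ((v + 1 + l) * (v' + 1 + l)) =
      W u u' v v' l * ((-u + l) * (-u' + l)) := by
  have hg : ∀ {a a' : ℂ}, Admissible a a' →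
      Complex.Gamma (a + 1 - l) = (a - l) * Complex.Gamma (a - l) := fun {a _} h => by
    rw [← Complex.Gamma_add_one _ (h.sub_ne_zero l)]
    congr 1
    ring
  have hg' : ∀ {a a' : ℂ}, Admissible a a' → a + 1 + l ≠ 0 ∧
      Complex.Gamma (a + 1 + (l + 1)) = (a + 1 + l) * Complex.Gamma (a + 1 + l) :=
    fun {a _} h => by
      have h0 : a + 1 + l ≠ 0 := by
        have := h.sub_ne_zero (-(1 + l))
        push_cast at this
        rwa [sub_neg_eq_add, ← add_assoc] at this
      refine ⟨h0, ?_⟩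
      rw [← Complex.Gamma_add_one _ h0, ← add_assoc]
  obtain ⟨h1, e1⟩ := hg' hv
  obtain ⟨h2, e2⟩ := hg' hv.symm
  have h3 := hu.sub_ne_zero l
  have h4 := hu.symm.sub_ne_zero l
  have e3 : ∀ a : ℂ, a + 1 - (l + 1) = a - l := fun a => by ring
  simp only [W, Int.cast_add, Int.cast_one, e1, e2, e3, hg hu, hg hu.symm]
  rw [show (-u + (l : ℂ)) * (-u' + l) = (u - l) * (u' - l) by ring]
  simp only [one_div, mul_inv]
  field_simp

theorem W_natCast_mul_prod (hu : Admissible u u') (hv : Admissible v v') (n : ℕ) :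
    W u u' v v' n * ((∏ j ∈ Finset.range n, (v + 1 + j)) * ∏ j ∈ Finset.range n, (v' + 1 + j)) =
      W u u' v v' 0 *
        ((∏ j ∈ Finset.range n, (-u + j)) * ∏ j ∈ Finset.range n, (-u' + j)) := by
  induction n with
  | zero => simp
  | succ n ih =>
    have h := W_add_one_mul hu hv n
    simp only [Int.cast_natCast] at h
    simp only [Finset.prod_range_succ, Nat.cast_succ]
    linear_combination
      ((∏ j ∈ Finset.range n, (v + 1 + j)) * ∏ j ∈ Finset.range n, (v' + 1 + j)) * h +
        (-u + n) * (-u' + n) * ih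

theorem W_natCast_add_one_mul_gammaSeq (hu : Admissible u u') (hv : Admissible v v') {n : ℕ}
    (hn : n ≠ 0) :
    W u u' v v' (n + 1) * (Complex.GammaSeq (-u) n * Complex.GammaSeq (-u') n) =
      W u u' v v' 0 * (Complex.GammaSeq (v + 1) n * Complex.GammaSeq (v' + 1) n) *
        (n : ℂ) ^ (-(u + u' + v + v' + 2)) := by
  have hn' : (n : ℂ) ≠ 0 := Nat.cast_ne_zero.2 hn
  have hprod : ∀ {a a' : ℂ}, Admissible a a' →
      ∏ j ∈ Finset.range (n + 1), (a + 1 + j) ≠ 0 ∧ ∏ j ∈ Finset.range (n + 1), (-a + j) ≠ 0 :=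
    fun {a _} h => ⟨Finset.prod_ne_zero_iff.2 fun j _ h0 =>
        h.sub_ne_zero (-(1 + j)) (by push_cast; linear_combination h0),
      Finset.prod_ne_zero_iff.2 fun j _ h0 =>
        h.sub_ne_zero j (by push_cast; linear_combination -h0)⟩
  have h1 := (hprod hu).2
  have h2 := (hprod hu.symm).2
  have h3 := (hprod hv).1
  have h4 := (hprod hv.symm).1
  have hW := W_natCast_mul_prod hu hv (n + 1)
  push_cast at hW
  have hpow : (n : ℂ) ^ (-u) * (n : ℂ) ^ (-u') =
      (n : ℂ) ^ (v + 1) * (n : ℂ) ^ (v' + 1) * (n : ℂ) ^ (-(u + u' + v + v' + 2)) := by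
    rw [← Complex.cpow_add _ _ hn', ← Complex.cpow_add _ _ hn', ← Complex.cpow_add _ _ hn']
    congr 1
    ring
  simp only [Complex.GammaSeq]
  generalize (∏ j ∈ Finset.range (n + 1), (-u + (j : ℂ))) = P1 at *
  generalize (∏ j ∈ Finset.range (n + 1), (-u' + (j : ℂ))) = P2 at *
  generalize (∏ j ∈ Finset.range (n + 1), (v + 1 + (j : ℂ))) = P3 at *
  generalize (∏ j ∈ Finset.range (n + 1), (v' + 1 + (j : ℂ))) = P4 at *
  rw [div_mul_div_comm, div_mul_div_comm, mul_div_assoc', mul_div_assoc', div_mul_eq_mul_div,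
    div_eq_div_iff (mul_ne_zero h1 h2) (mul_ne_zero h3 h4)]
  linear_combination (n : ℂ) ^ (-u) * (n : ℂ) ^ (-u') * (n.factorial : ℂ) ^ 2 * hW +
    W u u' v v' 0 * (P1 * P2) * (n.factorial : ℂ) ^ 2 * hpow

theorem isTheta_W_natCast_add_one (hu : Admissible u u') (hv : Admissible v v') :
    (fun n : ℕ => W u u' v v' (n + 1)) =Θ[atTop]
      fun n : ℕ => (n : ℝ) ^ (-((u + u' + v + v').re + 2)) := by
  have hlim := Complex.GammaSeq_tendsto_Gamma
  have hne : ∀ {a a' : ℂ}, Admissible a a' →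
      Complex.Gamma (-a) ≠ 0 ∧ Complex.Gamma (a + 1) ≠ 0 := fun {a _} h =>
    ⟨Complex.Gamma_ne_zero fun m hm => h.sub_ne_zero m (by push_cast; linear_combination -hm),
      Complex.Gamma_ne_zero fun m hm =>
        h.sub_ne_zero (-(1 + m)) (by push_cast; linear_combination hm)⟩
  have hden := mul_ne_zero (hne hu).1 (hne hu.symm).1
  have hnum := mul_ne_zero (W_ne_zero hu hv 0) (mul_ne_zero (hne hv).2 (hne hv.symm).2)
  have hdenlim := (hlim (-u)).mul (hlim (-u'))
  have hratio : Tendsto (fun n : ℕ => W u u' v v' (n + 1) /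
      (n : ℂ) ^ (-(u + u' + v + v' + 2))) atTop
      (𝓝 (W u u' v v' 0 * (Complex.Gamma (v + 1) * Complex.Gamma (v' + 1)) /
        (Complex.Gamma (-u) * Complex.Gamma (-u')))) := by
    refine ((((hlim (v + 1)).mul (hlim (v' + 1))).const_mul (W u u' v v' 0)).div
      hdenlim hden).congr' ?_
    filter_upwards [eventually_ne_atTop 0, hdenlim.eventually_ne hden] with n hn hd
    rw [Pi.div_apply, div_eq_div_iff hd
      (Complex.cpow_ne_zero_iff.2 (.inl (Nat.cast_ne_zero.2 hn))),
      W_natCast_add_one_mul_gammaSeq hu hv hn]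
  refine (isTheta_of_div_tendsto_nhds_ne_zero hratio (div_ne_zero hnum hden)).symm.trans
    (IsTheta.of_norm_eventuallyEq ?_)
  filter_upwards [eventually_gt_atTop 0] with n hn
  rw [Complex.norm_natCast_cpow_of_pos hn]
  simp

theorem summable_re_W_natCast_iff (hu : Admissible u u') (hv : Admissible v v') :
    Summable (fun n : ℕ => (W u u' v v' n).re) ↔ -1 < (u + u' + v + v').re := by
  have hre : ∀ n : ℕ, (W u u' v v' (n + 1)).re = ‖W u u' v v' (n + 1)‖ := fun n =>
    Complex.re_eq_norm.2 (W_nonneg hu hv _)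
  rw [← summable_nat_add_iff 1]
  simp only [Nat.cast_add, Nat.cast_one, hre]
  rw [(isTheta_W_natCast_add_one hu hv).norm_left.summable_iff_nat,
    Real.summable_nat_rpow]
  constructor <;> intro h <;> linarith

/-- For admissible couples `(u,u')` and `(v,v')`, the family of positive reals
`(W l)_{l ∈ ℤ}` is summable iff `u + u' + v + v' > -1`. -/
theorem summable_W_iff (u u' v v' : ℂ)
    (hu : Admissible u u') (hv : Admissible v v') :
    Summable (fun l : ℤ => (W u u' v v' l).re) ↔ -1 < (u + u' + v + v').re := by
  have hsum : v + v' + u + u' = u + u' + v + v' := by ring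
  rw [summable_int_iff_summable_nat_and_neg]
  simp only [W_neg]
  rw [summable_re_W_natCast_iff hu hv, summable_re_W_natCast_iff hv hu, hsum, and_self]
end

section
/- Let (u,u') and (v,v') be admissible couples, N ≥ 1, a⁺(l) := (u−l)(u'−l), a⁻(l) := (v+l)(v'+l), and C_N := (N(N−1)/2)·(u+u'+v+v') − N(N−1)(N−2)/3. Then the Vandermonde function V_N is an eigenfunction of the free difference operator: for every ℓ ∈ ℤ^N, ∑_{i=1}^N [ a⁺(ℓ_i)·(V_N(ℓ+ε_i) − V_N(ℓ)) + a⁻(ℓ_i)·(V_N(ℓ−ε_i) − V_N(ℓ)) ] = −C_N · V_N(ℓ). -/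
/-- The Vandermonde function `V_N(ℓ) = ∏_{1 ≤ i < j ≤ N} (ℓ_i - ℓ_j)`. -/
def Vand (N : ℕ) (ℓ : Fin N → ℤ) : ℤ :=
  ∏ i : Fin N, ∏ j ∈ Finset.Ioi i, (ℓ i - ℓ j)

/-- `ℓ + ε_i`: add `1` to the `i`-th coordinate. -/
def up {N : ℕ} (ℓ : Fin N → ℤ) (i : Fin N) : Fin N → ℤ :=
  Function.update ℓ i (ℓ i + 1)

/-- `ℓ - ε_i`: subtract `1` from the `i`-th coordinate. -/
def down {N : ℕ} (ℓ : Fin N → ℤ) (i : Fin N) : Fin N → ℤ :=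
  Function.update ℓ i (ℓ i - 1)

open Polynomial in
/-- The three leading terms of `x ^ 2 * (x + c) ^ k`; the remainder has degree less than `k`. -/
theorem exists_sq_mul_X_add_C_pow {R : Type*} [CommRing R] (c : R) (k : ℕ) :
    ∃ r : R[X], r.degree < k ∧ X ^ 2 * (X + C c) ^ k =
      X ^ (k + 2) + C (k * c) * X ^ (k + 1) + C (k.choose 2 * c ^ 2) * X ^ k + r := by
  induction k with
  | zero => exact ⟨0, by simp, by simp⟩
  | succ k ih =>
    obtain ⟨r, hr, h⟩ := ih
    refine ⟨C (k.choose 2 * c ^ 3) * X ^ k + (r * X + C c * r), ?_, ?_⟩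
    · rw [degree_lt_iff_coeff_zero] at hr ⊢
      intro m hm
      obtain ⟨m, rfl⟩ : ∃ n, m = n + 1 := ⟨m - 1, by omega⟩
      simp only [coeff_add, coeff_C_mul, coeff_mul_X, coeff_X_pow]
      simp [hr m (by omega), hr (m + 1) (by omega), show m + 1 ≠ k by omega]
    · have hc : ((k + 1).choose 2 : R) = k + k.choose 2 := by
        rw [Nat.choose_succ_succ']; simp
      rw [pow_succ (X + C c), ← mul_assoc, h, hc]
      simp only [map_mul, map_add, map_pow, Nat.cast_succ, map_one]
      ring

open Polynomial in
/-- The two leading terms of `x * (x + c) ^ k`; the remainder has degree less than `k`. -/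
theorem exists_mul_X_add_C_pow {R : Type*} [CommRing R] (c : R) (k : ℕ) :
    ∃ r : R[X], r.degree < k ∧ X * (X + C c) ^ k = X ^ (k + 1) + C (k * c) * X ^ k + r := by
  induction k with
  | zero => exact ⟨0, by simp, by simp⟩
  | succ k ih =>
    obtain ⟨r, hr, h⟩ := ih
    refine ⟨C (k * c ^ 2) * X ^ k + (r * X + C c * r), ?_, ?_⟩
    · rw [degree_lt_iff_coeff_zero] at hr ⊢
      intro m hm
      obtain ⟨m, rfl⟩ : ∃ n, m = n + 1 := ⟨m - 1, by omega⟩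
      simp only [coeff_add, coeff_C_mul, coeff_mul_X, coeff_X_pow]
      simp [hr m (by omega), hr (m + 1) (by omega), show m + 1 ≠ k by omega]
    · rw [pow_succ (X + C c), ← mul_assoc, h]
      simp only [map_mul, map_add, map_pow, Nat.cast_succ, map_one]
      ring

open Polynomial in
/-- The leading term of `(x + c) ^ k`; the remainder has degree less than `k`. -/
theorem exists_X_add_C_pow {R : Type*} [CommRing R] (c : R) (k : ℕ) :
    ∃ r : R[X], r.degree < k ∧ (X + C c) ^ k = X ^ k + r := by
  nontriviality R
  refine ⟨(X + C c) ^ k - X ^ k, ?_, by ring⟩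
  have hd : ((X + C c) ^ k).degree = (k : WithBot ℕ) := by
    rw [degree_pow' (by simp), degree_X_add_C]; simp
  rw [← hd]
  refine degree_sub_lt_left (by simp [hd]) ((monic_X_add_C c).pow k).ne_zero ?_
  rw [((monic_X_add_C c).pow k).leadingCoeff, (monic_X_pow k).leadingCoeff]

open Polynomial in
/-- The one-variable difference operator with coefficients `(u - x) * (u' - x)` and
`(v + x) * (v' + x)` acts triangularly on monomials. -/
theorem exists_difference_pow (u u' v v' : ℂ) (k : ℕ) :
    ∃ r : ℂ[X], r.degree < k ∧ ∀ x : ℂ,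
      (u - x) * (u' - x) * ((x + 1) ^ k - x ^ k)
        + (v + x) * (v' + x) * ((x - 1) ^ k - x ^ k)
      = (k * (k - 1) - k * (u + u' + v + v')) * x ^ k + r.eval x := by
  obtain ⟨r₂, hr₂, h₂⟩ := exists_sq_mul_X_add_C_pow (1 : ℂ) k
  obtain ⟨s₂, hs₂, g₂⟩ := exists_sq_mul_X_add_C_pow (-1 : ℂ) k
  obtain ⟨r₁, hr₁, h₁⟩ := exists_mul_X_add_C_pow (1 : ℂ) k
  obtain ⟨s₁, hs₁, g₁⟩ := exists_mul_X_add_C_pow (-1 : ℂ) k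
  obtain ⟨r₀, hr₀, h₀⟩ := exists_X_add_C_pow (1 : ℂ) k
  obtain ⟨s₀, hs₀, g₀⟩ := exists_X_add_C_pow (-1 : ℂ) k
  refine ⟨r₂ + s₂ + C (-(u + u')) * r₁ + C (v + v') * s₁ + C (u * u') * r₀ + C (v * v') * s₀,
    ?_, fun x => ?_⟩
  · rw [degree_lt_iff_coeff_zero] at *
    intro m hm
    simp only [coeff_add, coeff_C_mul]
    simp [hr₂ m hm, hs₂ m hm, hr₁ m hm, hs₁ m hm, hr₀ m hm, hs₀ m hm]
  · have e := fun {p q : ℂ[X]} (h : p = q) => congrArg (eval x) h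
    have h₂ := e h₂
    have g₂ := e g₂
    have h₁ := e h₁
    have g₁ := e g₁
    have h₀ := e h₀
    have g₀ := e g₀
    simp only [eval_mul, eval_add, eval_pow, eval_X, eval_C, Nat.cast_choose_two,
      ← sub_eq_add_neg] at h₂ g₂ h₁ g₁ h₀ g₀ ⊢
    linear_combination h₂ + g₂ - (u + u') * h₁ + (v + v') * g₁ + u * u' * h₀ + v * v' * g₀

/-- Replacing in turn each row of `M` by the corresponding row of `M * T` and summing the
determinants multiplies the determinant by the trace of `T`. -/
theorem sum_det_updateRow_mul {n R : Type*} [Fintype n] [DecidableEq n] [CommRing R]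
    (M T : Matrix n n R) :
    ∑ i, (M.updateRow i ((M * T).row i)).det = T.trace * M.det := by
  have h : ∀ i, (M.updateRow i ((M * T).row i)).det = (M * T * M.adjugate) i i := by
    intro i
    rw [← Matrix.cramer_transpose_apply, Matrix.cramer_eq_adjugate_mulVec,
      ← Matrix.adjugate_transpose, Matrix.mulVec_transpose]
    rfl
  calc ∑ i, (M.updateRow i ((M * T).row i)).det = (M * T * M.adjugate).trace :=
        Finset.sum_congr rfl fun i _ => h i
    _ = T.trace * M.det := by
      rw [mul_assoc, Matrix.trace_mul_comm, mul_assoc, Matrix.adjugate_mul]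
      simp [mul_comm]

theorem vandermonde_update {n : ℕ} {R : Type*} [CommRing R] (v : Fin n → R) (i : Fin n) (x : R) :
    Matrix.vandermonde (Function.update v i x) =
      (Matrix.vandermonde v).updateRow i fun j => x ^ (j : ℕ) := by
  ext a b
  by_cases h : a = i
  · subst h; simp [Matrix.vandermonde_apply]
  · simp [Matrix.vandermonde_apply, h]

/-- `Vand` is the Vandermonde determinant up to a sign independent of the variables. -/
theorem Vand_eq_sign_mul_det (N : ℕ) (ℓ : Fin N → ℤ) :
    (Vand N ℓ : ℂ) = (∏ i : Fin N, ∏ _j ∈ Finset.Ioi i, (-1)) *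
      (Matrix.vandermonde fun i => (ℓ i : ℂ)).det := by
  rw [Matrix.det_vandermonde, Vand]
  simp only [← Finset.prod_mul_distrib]
  push_cast
  exact Finset.prod_congr rfl fun i _ => Finset.prod_congr rfl fun j _ => by ring

theorem Vand_update (N : ℕ) (ℓ : Fin N → ℤ) (i : Fin N) (x : ℤ) :
    (Vand N (Function.update ℓ i x) : ℂ) = (∏ i : Fin N, ∏ _j ∈ Finset.Ioi i, (-1)) *
      ((Matrix.vandermonde fun i => (ℓ i : ℂ)).updateRow i fun j => (x : ℂ) ^ (j : ℕ)).det := by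
  rw [Vand_eq_sign_mul_det, ← vandermonde_update]
  congr 3
  ext j
  by_cases h : j = i
  · subst h; simp
  · simp [h]

theorem sum_eigenvalues (N : ℕ) (s : ℂ) :
    ∑ k : Fin N, (((k : ℕ) : ℂ) * ((k : ℕ) - 1) - (k : ℕ) * s) =
      -((N : ℂ) * (N - 1) / 2 * s - (N : ℂ) * (N - 1) * (N - 2) / 3) := by
  rw [Fin.sum_univ_eq_sum_range (fun k : ℕ => (k : ℂ) * (k - 1) - k * s) N]
  induction N with
  | zero => simp
  | succ n ih => rw [Finset.sum_range_succ, ih]; push_cast; ring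

/-- The Vandermonde `V_N` is an eigenfunction of the free difference operator
`D_N^free = ∑_i D^{[i]}`, with eigenvalue `-C_N`, where
`C_N = (N(N-1)/2)(u+u'+v+v') - N(N-1)(N-2)/3`. -/
theorem vandermonde_eigenfunction (u u' v v' : ℂ)
    (hu : Admissible u u') (hv : Admissible v v')
    (N : ℕ) (hN : 1 ≤ N) (ℓ : Fin N → ℤ) :
    ∑ i : Fin N,
      ((u - ℓ i) * (u' - ℓ i) * ((Vand N (up ℓ i) : ℂ) - (Vand N ℓ : ℂ))
        + (v + ℓ i) * (v' + ℓ i) * ((Vand N (down ℓ i) : ℂ) - (Vand N ℓ : ℂ)))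
      = -(((N : ℂ) * ((N : ℂ) - 1) / 2) * (u + u' + v + v')
            - (N : ℂ) * ((N : ℂ) - 1) * ((N : ℂ) - 2) / 3) * (Vand N ℓ : ℂ) := by
  choose r hr h using exists_difference_pow u u' v v'
  set M := Matrix.vandermonde fun i => (ℓ i : ℂ) with hM
  let T : Matrix (Fin N) (Fin N) ℂ := Matrix.of fun j k =>
    (if j = k then ((k : ℕ) : ℂ) * ((k : ℕ) - 1) - (k : ℕ) * (u + u' + v + v') else 0)
      + (r k).coeff j
  have hT : T.trace = ∑ k : Fin N,
      (((k : ℕ) : ℂ) * ((k : ℕ) - 1) - (k : ℕ) * (u + u' + v + v')) := by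
    refine Finset.sum_congr rfl fun k _ => ?_
    simp [T, Matrix.diag_apply, Polynomial.coeff_eq_zero_of_degree_lt (hr k)]
  have hrow : ∀ i, (M * T).row i =
      ((u - ℓ i) * (u' - ℓ i)) • ((fun j : Fin N => ((ℓ i + 1 : ℤ) : ℂ) ^ (j : ℕ)) - M.row i)
        + ((v + ℓ i) * (v' + ℓ i)) •
          ((fun j : Fin N => ((ℓ i - 1 : ℤ) : ℂ) ^ (j : ℕ)) - M.row i) := by
    intro i
    ext k
    have hdeg : (r k).degree < N := (hr k).trans (by exact_mod_cast k.isLt)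
    have hev : (r k).eval (ℓ i : ℂ) = ∑ j : Fin N, (r k).coeff j * (ℓ i : ℂ) ^ (j : ℕ) := by
      rw [Fin.sum_univ_eq_sum_range fun j => (r k).coeff j * (ℓ i : ℂ) ^ j]
      by_cases h0 : r k = 0
      · simp [h0]
      · exact Polynomial.eval_eq_sum_range' ((Polynomial.natDegree_lt_iff_degree_lt h0).2 hdeg) _
    have := h k (ℓ i)
    simp only [Pi.add_apply, Pi.smul_apply, Pi.sub_apply, smul_eq_mul, hM, Matrix.row_apply,
      Matrix.vandermonde_apply, Int.cast_add, Int.cast_sub, Int.cast_one, this, hev]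
    simp [Matrix.mul_apply, Matrix.vandermonde_apply, T, mul_add, Finset.sum_add_distrib, mul_comm]
  rw [← sum_eigenvalues, ← hT, Vand_eq_sign_mul_det, mul_left_comm, ← sum_det_updateRow_mul,
    Finset.mul_sum]
  refine Finset.sum_congr rfl fun i _ => ?_
  have hlin : ∀ w, (M.updateRow i w).det = M.transpose.cramer w i :=
    fun w => (Matrix.cramer_transpose_apply M w i).symm
  have hself : M.det = M.transpose.cramer (M.row i) i := by
    rw [← hlin, Matrix.row_def, Matrix.updateRow_eq_self]
  rw [up, down, Vand_update, Vand_update, hrow, hlin, hlin, hlin, ← hM, hself]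
  simp only [map_add, map_sub, map_smul, Pi.add_apply, Pi.sub_apply, Pi.smul_apply, smul_eq_mul]
  ring
end

section
/- Let (u,u') and (v,v') be admissible couples and N ≥ 1. For ℓ ∈ Ω_N define M̃(ℓ) := (∏_{k=1}^N W(ℓ_k)) · V_N(ℓ)², and define the jump rates q_i⁺(ℓ) := (V_N(ℓ+ε_i)/V_N(ℓ))·(u−ℓ_i)(u'−ℓ_i) and q_i⁻(ℓ) := (V_N(ℓ−ε_i)/V_N(ℓ))·(v+ℓ_i)(v'+ℓ_i) (well defined since V_N(ℓ) ≠ 0 for ℓ ∈ Ω_N). Then M̃ is a symmetrizing measure for the N-particle chain: for every ℓ ∈ Ω_N and every i ∈ {1,…,N} with ℓ+ε_i ∈ Ω_N, one has M̃(ℓ)·q_i⁺(ℓ) = M̃(ℓ+ε_i)·q_i⁻(ℓ+ε_i). -/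
/-- Membership in `Ω_N = {ℓ ∈ ℤ^N : ℓ_1 > ℓ_2 > ⋯ > ℓ_N}`. -/
def inOmega {N : ℕ} (ℓ : Fin N → ℤ) : Prop :=
  ∀ i j : Fin N, i < j → ℓ j < ℓ i

/-- `M̃(ℓ) = (∏_k W(ℓ_k)) · V_N(ℓ)²`. -/
noncomputable def Mtilde (u u' v v' : ℂ) (N : ℕ) (ℓ : Fin N → ℤ) : ℝ :=
  (∏ k : Fin N, (W u u' v v' (ℓ k)).re) * (Vand N ℓ : ℝ) ^ 2

/-- The jump rate of `ℓ → ℓ + ε_i`: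
`q_i⁺(ℓ) = (V_N(ℓ+ε_i)/V_N(ℓ)) (u-ℓ_i)(u'-ℓ_i)`. -/
noncomputable def qplus (u u' : ℂ) (N : ℕ) (ℓ : Fin N → ℤ) (i : Fin N) : ℝ :=
  ((Vand N (up ℓ i) : ℝ) / (Vand N ℓ : ℝ)) * ((u - ℓ i) * (u' - ℓ i)).re

/-- The jump rate of `ℓ → ℓ - ε_i`:
`q_i⁻(ℓ) = (V_N(ℓ-ε_i)/V_N(ℓ)) (v+ℓ_i)(v'+ℓ_i)`. -/
noncomputable def qminus (v v' : ℂ) (N : ℕ) (ℓ : Fin N → ℤ) (i : Fin N) : ℝ :=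
  ((Vand N (down ℓ i) : ℝ) / (Vand N ℓ : ℝ)) * ((v + ℓ i) * (v' + ℓ i)).re

theorem Admissible.ne_zero {u u' : ℂ} (hu : Admissible u u') (l : ℤ) :
    u - l ≠ 0 ∧ u' - l ≠ 0 := by
  constructor <;> intro h <;> simpa [h] using (hu l).2

/-- The recurrence satisfied by the weight, from `Γ(s + 1) = s Γ(s)`. -/
theorem W_succ_mul {u u' v v' : ℂ} (hu : Admissible u u') (hv : Admissible v v') (l : ℤ) :
    W u u' v v' l * ((u - l) * (u' - l))
      = W u u' v v' (l + 1) * ((v + (l + 1 : ℤ)) * (v' + (l + 1 : ℤ))) := by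
  obtain ⟨h1, h2⟩ := hu.ne_zero l
  obtain ⟨h3, h4⟩ := hv.ne_zero (-(l + 1))
  have e3 : v - ((-(l + 1) : ℤ) : ℂ) = v + 1 + l := by push_cast; ring
  have e4 : v' - ((-(l + 1) : ℤ) : ℂ) = v' + 1 + l := by push_cast; ring
  rw [e3] at h3
  rw [e4] at h4
  have g1 : Complex.Gamma (u + 1 - l) = (u - l) * Complex.Gamma (u - l) := by
    rw [← Complex.Gamma_add_one _ h1]; congr 1; ring
  have g2 : Complex.Gamma (u' + 1 - l) = (u' - l) * Complex.Gamma (u' - l) := by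
    rw [← Complex.Gamma_add_one _ h2]; congr 1; ring
  have g3 : Complex.Gamma (v + 1 + (l + 1)) = (v + 1 + l) * Complex.Gamma (v + 1 + l) := by
    rw [← Complex.Gamma_add_one _ h3]; congr 1; ring
  have g4 : Complex.Gamma (v' + 1 + (l + 1)) = (v' + 1 + l) * Complex.Gamma (v' + 1 + l) := by
    rw [← Complex.Gamma_add_one _ h4]; congr 1; ring
  have a (w : ℂ) : w + 1 - (l + 1) = w - l := by ring
  have b (w : ℂ) : w + (l + 1) = w + 1 + l := by ring
  unfold W
  push_cast
  rw [g1, g2, g3, g4, a u, a u', b v, b v']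
  simp only [one_div, mul_inv]
  field_simp

theorem W_re_succ_mul {u u' v v' : ℂ} (hu : Admissible u u') (hv : Admissible v v') (l : ℤ) :
    (W u u' v v' l).re * ((u - l) * (u' - l)).re
      = (W u u' v v' (l + 1)).re * ((v + (l + 1 : ℤ)) * (v' + (l + 1 : ℤ))).re := by
  have h := congrArg Complex.re (W_succ_mul hu hv l)
  have hvi := (hv (-(l + 1))).1
  rw [Int.cast_neg, sub_neg_eq_add, sub_neg_eq_add] at hvi
  rw [Complex.mul_re, Complex.mul_re (W u u' v v' (l + 1)), (hu l).1, hvi] at h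
  simpa only [mul_zero, sub_zero] using h

theorem Vand_ne_zero {N : ℕ} {ℓ : Fin N → ℤ} (hℓ : inOmega ℓ) : Vand N ℓ ≠ 0 := by
  refine Finset.prod_ne_zero_iff.2 fun i _ => Finset.prod_ne_zero_iff.2 fun j hj => ?_
  exact (sub_pos.2 (hℓ i j (Finset.mem_Ioi.1 hj))).ne'

theorem down_up {N : ℕ} (ℓ : Fin N → ℤ) (i : Fin N) : down (up ℓ i) i = ℓ := by
  simp [down, up]

/-- `M̃` is a symmetrizing measure for the `N`-particle chain: for `ℓ ∈ Ω_N` and `i`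
with `ℓ + ε_i ∈ Ω_N`, one has `M̃(ℓ) q_i⁺(ℓ) = M̃(ℓ+ε_i) q_i⁻(ℓ+ε_i)`. -/
theorem Mtilde_symmetrizing (u u' v v' : ℂ)
    (hu : Admissible u u') (hv : Admissible v v')
    (N : ℕ) (hN : 1 ≤ N) (ℓ : Fin N → ℤ) (hℓ : inOmega ℓ)
    (i : Fin N) (hup : inOmega (up ℓ i)) :
    Mtilde u u' v v' N ℓ * qplus u u' N ℓ i
      = Mtilde u u' v v' N (up ℓ i) * qminus v v' N (up ℓ i) i := by
  have h0 : (Vand N ℓ : ℝ) ≠ 0 := Int.cast_ne_zero.2 (Vand_ne_zero hℓ)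
  have h1 : (Vand N (up ℓ i) : ℝ) ≠ 0 := Int.cast_ne_zero.2 (Vand_ne_zero hup)
  have hi : up ℓ i i = ℓ i + 1 := Function.update_self ..
  have hW := W_re_succ_mul hu hv (ℓ i)
  have hne : ∏ k ∈ Finset.univ.erase i, (W u u' v v' (up ℓ i k)).re
      = ∏ k ∈ Finset.univ.erase i, (W u u' v v' (ℓ k)).re :=
    Finset.prod_congr rfl fun k hk => by
      rw [up, Function.update_of_ne (Finset.ne_of_mem_erase hk)]
  unfold Mtilde qplus qminus
  rw [down_up, ← Finset.mul_prod_erase _ _ (Finset.mem_univ i),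
    ← Finset.mul_prod_erase _ (fun k => (W u u' v v' (up ℓ i k)).re) (Finset.mem_univ i), hne, hi]
  set P := ∏ k ∈ Finset.univ.erase i, (W u u' v v' (ℓ k)).re
  calc _ = (W u u' v v' (ℓ i)).re * ((u - ℓ i) * (u' - ℓ i)).re
        * (P * Vand N ℓ * Vand N (up ℓ i)) := by field_simp
    _ = _ := by rw [hW]; field_simp
end

section
/- Intertwining relation for the Pascal triangle (Example 6.A): fix real numbers a > 0, b > 0 and an integer N ≥ 2. For K ≥ 1 and F : ℤ → ℝ define (D_K F)(n) := (K−n)(n+a)·[F(n+1)−F(n)] + n(K+b−n)·[F(n−1)−F(n)], and define (ΛF)(n) := ((N−n)/N)·F(n) + (n/N)·F(n−1). Then for every F : ℤ → ℝ and every integer n with 0 ≤ n ≤ N, one has (D_N(ΛF))(n) = (Λ(D_{N−1}F))(n). -/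
/-- The difference operator `D_K` of Example 6.A:
`(D_K F)(n) = (K-n)(n+a)[F(n+1)-F(n)] + n(K+b-n)[F(n-1)-F(n)]`. -/
noncomputable def Dop (a b : ℝ) (K : ℕ) (F : ℤ → ℝ) (n : ℤ) : ℝ :=
  ((K : ℝ) - (n : ℝ)) * ((n : ℝ) + a) * (F (n + 1) - F n)
    + (n : ℝ) * ((K : ℝ) + b - (n : ℝ)) * (F (n - 1) - F n)

/-- The Pascal-triangle link applied to a function:
`(ΛF)(n) = ((N-n)/N) F(n) + (n/N) F(n-1)`. -/
noncomputable def Lop (N : ℕ) (F : ℤ → ℝ) (n : ℤ) : ℝ :=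
  (((N : ℝ) - (n : ℝ)) / (N : ℝ)) * F n + ((n : ℝ) / (N : ℝ)) * F (n - 1)

/-- Intertwining relation for the Pascal triangle (Example 6.A): for `a, b > 0`, `N ≥ 2`,
any `F : ℤ → ℝ` and any `0 ≤ n ≤ N`, `(D_N (ΛF))(n) = (Λ (D_{N-1} F))(n)`. -/
theorem pascal_intertwining (a b : ℝ) (ha : 0 < a) (hb : 0 < b)
    (N : ℕ) (hN : 2 ≤ N) (F : ℤ → ℝ) (n : ℤ) (hn0 : 0 ≤ n) (hnN : n ≤ (N : ℤ)) :
    Dop a b N (Lop N F) n = Lop N (Dop a b (N - 1) F) n := by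
  have hN0 : (N : ℝ) ≠ 0 := by positivity
  have hcast : ((N - 1 : ℕ) : ℝ) = (N : ℝ) - 1 := by
    rw [Nat.cast_sub (by omega), Nat.cast_one]
  have hadd : n + 1 - 1 = n := by ring
  simp only [Dop, Lop, hcast, hadd, sub_add_cancel]
  push_cast
  field_simp
  ring
end

section
/- The boundary of the Pascal triangle is [0,1]: let (M_N)_{N≥1} be a sequence with M_N : {0,…,N} → [0,∞), ∑_{n=0}^N M_N(n) = 1 for all N, and the coherence relation ((N−m)/N)·M_N(m) + ((m+1)/N)·M_N(m+1) = M_{N−1}(m) for all N ≥ 2 and 0 ≤ m ≤ N−1. Then there exists a unique Borel probability measure μ on [0,1] such that M_N(n) = ∫₀¹ binom(N,n)·x^n·(1−x)^{N−n} dμ(x) for every N ≥ 1 and 0 ≤ n ≤ N. -/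
open MeasureTheory

open Filter Topology

/-- If two finite measures carried by `[0,1]` have the same moments, they are equal. -/
lemma measure_eq_of_moments_eq {μ ν : Measure ℝ} [IsFiniteMeasure μ] [IsFiniteMeasure ν]
    (hμ : μ (Set.Icc (0 : ℝ) 1)ᶜ = 0) (hν : ν (Set.Icc (0 : ℝ) 1)ᶜ = 0)
    (h : ∀ k : ℕ, ∫ x, x ^ k ∂μ = ∫ x, x ^ k ∂ν) : μ = ν := by
  have integrable_of_continuous : ∀ {ρ : Measure ℝ} [IsFiniteMeasure ρ],
      ρ (Set.Icc (0 : ℝ) 1)ᶜ = 0 → ∀ {f : ℝ → ℝ}, Continuous f → Integrable f ρ := by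
    intro ρ _ hρ f hf
    rw [← Measure.restrict_eq_self_of_ae_mem (μ := ρ) (s := Set.Icc (0 : ℝ) 1) hρ]
    exact hf.continuousOn.integrableOn_compact isCompact_Icc
  have poly : ∀ p : Polynomial ℝ, ∫ x, p.eval x ∂μ = ∫ x, p.eval x ∂ν := by
    intro p
    induction p using Polynomial.induction_on' with
    | add p q hp hq =>
      simp only [Polynomial.eval_add]
      rw [integral_add (integrable_of_continuous hμ p.continuous)
          (integrable_of_continuous hμ q.continuous),
        integral_add (integrable_of_continuous hν p.continuous)
          (integrable_of_continuous hν q.continuous), hp, hq]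
    | monomial n a =>
      simp only [Polynomial.eval_monomial, integral_const_mul, h]
  refine ext_of_forall_integral_eq_of_IsFiniteMeasure fun f => ?_
  have approx : ∀ {ρ : Measure ℝ} [IsFiniteMeasure ρ], ρ (Set.Icc (0 : ℝ) 1)ᶜ = 0 →
      ∀ (ε : ℝ) (p : Polynomial ℝ), (∀ x ∈ Set.Icc (0 : ℝ) 1, |p.eval x - f x| < ε) →
      |∫ x, p.eval x ∂ρ - ∫ x, f x ∂ρ| ≤ ε * ρ.real Set.univ := by
    intro ρ _ hρ ε p hp
    rw [← integral_sub (integrable_of_continuous hρ p.continuous)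
      (integrable_of_continuous hρ f.continuous)]
    have hmem : ∀ᵐ x ∂ρ, x ∈ Set.Icc (0 : ℝ) 1 := hρ
    rw [← Real.norm_eq_abs]
    refine norm_integral_le_of_norm_le_const (hmem.mono fun x hx => ?_)
    exact (hp x hx).le
  have key : ∀ ε : ℝ, 0 < ε →
      |∫ x, f x ∂μ - ∫ x, f x ∂ν| ≤ ε * (μ.real Set.univ + ν.real Set.univ) := by
    intro ε hε
    obtain ⟨p, hp⟩ := exists_polynomial_near_of_continuousOn 0 1 f f.continuous.continuousOn ε hε
    have h₁ := approx hμ ε p hp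
    have h₂ := approx hν ε p hp
    rw [poly p] at h₁
    rw [abs_le] at *
    constructor <;> linarith [h₁.1, h₁.2, h₂.1, h₂.2]
  have hlim : Tendsto (fun ε : ℝ => ε * (μ.real Set.univ + ν.real Set.univ)) (𝓝[>] 0) (𝓝 0) := by
    refine tendsto_nhdsWithin_of_tendsto_nhds ?_
    simpa using (continuous_mul_const (μ.real Set.univ + ν.real Set.univ)).tendsto (0 : ℝ)
  have hle := ge_of_tendsto hlim (eventually_mem_nhdsWithin.mono fun ε hε => key ε hε)
  exact sub_eq_zero.mp (abs_eq_zero.mp (le_antisymm hle (abs_nonneg _)))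

/-- The ratio of binomial coefficients `binom(n,j) / binom(N,j)` is close to `(n/N)^j`. -/
lemma abs_div_pow_sub_choose_div_choose_le {N n k : ℕ} (hk : k < N) (hn : n ≤ N) :
    ∀ j ≤ k, |((n : ℝ) / N) ^ j - (n.choose j : ℝ) / (N.choose j : ℝ)|
      ≤ j * ((k : ℝ) / ((N : ℝ) - k)) := by
  intro j
  induction j with
  | zero => simp
  | succ j ih =>
    intro hj
    have ih := ih (by omega)
    have hkN : (k : ℝ) < N := by exact_mod_cast hk
    have hjk : (j : ℝ) ≤ k := by exact_mod_cast (by omega : j ≤ k)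
    have hnN : (n : ℝ) ≤ N := by exact_mod_cast hn
    have hn0 : (0 : ℝ) ≤ n := n.cast_nonneg
    have hj0 : (0 : ℝ) ≤ j := j.cast_nonneg
    have hN0 : (0 : ℝ) < N := by linarith
    have hNj : (0 : ℝ) < (N : ℝ) - j := by linarith
    have hNk : (0 : ℝ) < (N : ℝ) - k := by linarith
    set x : ℝ := (n : ℝ) / N with hx
    set P : ℝ := (n.choose j : ℝ) / (N.choose j : ℝ) with hP
    set y : ℝ := ((n - j : ℕ) : ℝ) / ((N : ℝ) - j) with hy
    have hCj : (0 : ℝ) < N.choose j := by exact_mod_cast Nat.choose_pos (by omega)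
    have hCj' : (0 : ℝ) < N.choose (j + 1) := by exact_mod_cast Nat.choose_pos (by omega)
    have hratio : (n.choose (j + 1) : ℝ) / (N.choose (j + 1) : ℝ) = P * y := by
      have h₁ : (n.choose (j + 1) : ℝ) * (j + 1) = n.choose j * ((n - j : ℕ) : ℝ) := by
        exact_mod_cast Nat.choose_succ_right_eq n j
      have h₂ : (N.choose (j + 1) : ℝ) * (j + 1) = N.choose j * ((N : ℝ) - j) := by
        rw [← Nat.cast_sub (by omega)]
        exact_mod_cast Nat.choose_succ_right_eq N j
      have hj1 : (0 : ℝ) < (j : ℝ) + 1 := by positivity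
      rw [← mul_div_mul_right _ _ hj1.ne', h₁, h₂, hP, hy, div_mul_div_comm]
    have hx0 : 0 ≤ x := by positivity
    have hx1 : x ≤ 1 := (div_le_one hN0).2 hnN
    have hP0 : 0 ≤ P := by positivity
    have hP1 : P ≤ 1 := (div_le_one hCj).2 (by exact_mod_cast Nat.choose_le_choose j hn)
    have hxy : |x - y| ≤ (k : ℝ) / ((N : ℝ) - k) := by
      have hle : (j : ℝ) / ((N : ℝ) - j) ≤ (k : ℝ) / ((N : ℝ) - k) := by gcongr
      refine le_trans ?_ hle
      rcases le_total j n with hjn | hjn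
      · have hxy' : x - y = j * ((N : ℝ) - n) / (N * ((N : ℝ) - j)) := by
          rw [hx, hy, Nat.cast_sub hjn]
          field_simp
          ring
        rw [hxy', abs_of_nonneg (div_nonneg (mul_nonneg hj0 (by linarith)) (by positivity)),
          div_le_div_iff₀ (by positivity) hNj]
        have : 0 ≤ j * n * ((N : ℝ) - j) := by positivity
        nlinarith
      · have hy0 : y = 0 := by rw [hy, Nat.sub_eq_zero_of_le hjn]; simp
        have hnj : (n : ℝ) ≤ j := by exact_mod_cast hjn
        rw [hy0, sub_zero, abs_of_nonneg hx0, hx]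
        gcongr
        linarith
    calc |x ^ (j + 1) - (n.choose (j + 1) : ℝ) / (N.choose (j + 1) : ℝ)|
        = |(x ^ j - P) * x + P * (x - y)| := by rw [hratio]; congr 1; ring
      _ ≤ |x ^ j - P| * x + P * |x - y| := by
          refine (abs_add_le _ _).trans_eq ?_
          rw [abs_mul, abs_mul, abs_of_nonneg hx0, abs_of_nonneg hP0]
      _ ≤ |x ^ j - P| + |x - y| := by
          nlinarith [abs_nonneg (x ^ j - P), abs_nonneg (x - y)]
      _ ≤ ((j + 1 : ℕ) : ℝ) * ((k : ℝ) / ((N : ℝ) - k)) := by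
          push_cast
          linarith

/-- Binomial moments of a coherent family. -/
lemma sum_mul_choose_of_coherent {M : ℕ → ℕ → ℝ}
    (hcoh : ∀ N : ℕ, 2 ≤ N → ∀ m : ℕ, m ≤ N - 1 →
      (((N : ℝ) - (m : ℝ)) / (N : ℝ)) * M N m + (((m : ℝ) + 1) / (N : ℝ)) * M N (m + 1)
        = M (N - 1) m) {j : ℕ} (hj : 1 ≤ j) {N : ℕ} (hN : j ≤ N) :
    ∑ n ∈ Finset.range (N + 1), M N n * (n.choose j : ℝ) = M j j * (N.choose j : ℝ) := by
  induction N, hN using Nat.le_induction with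
  | base =>
    rw [Finset.sum_range_succ, Finset.sum_eq_zero, zero_add]
    intro n hn
    rw [Nat.choose_eq_zero_of_lt (Finset.mem_range.1 hn)]
    simp
  | succ N hN ih =>
    have hstep : ∑ n ∈ Finset.range (N + 1), M N n * (n.choose j : ℝ)
        = ((N : ℝ) + 1 - j) / (N + 1) *
          ∑ n ∈ Finset.range (N + 1 + 1), M (N + 1) n * (n.choose j : ℝ) := by
      have h₁ : ∀ n ∈ Finset.range (N + 1), M N n * (n.choose j : ℝ)
          = ((N : ℝ) + 1 - n) / (N + 1) * M (N + 1) n * (n.choose j : ℝ)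
            + ((n + 1 : ℕ) : ℝ) / (N + 1) * M (N + 1) (n + 1) * ((n + 1 - 1).choose j : ℝ) := by
        intro n hn
        have := hcoh (N + 1) (by omega) n (by have := Finset.mem_range.1 hn; omega)
        rw [Nat.add_sub_cancel] at this
        rw [← this]
        rw [Nat.add_sub_cancel]
        push_cast
        ring
      have h₂ := Finset.sum_range_succ (fun n : ℕ =>
        ((N : ℝ) + 1 - n) / (N + 1) * M (N + 1) n * (n.choose j : ℝ)) (N + 1)
      have h₃ := Finset.sum_range_succ' (fun n : ℕ =>
        (n : ℝ) / (N + 1) * M (N + 1) n * ((n - 1).choose j : ℝ)) (N + 1)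
      rw [Finset.sum_congr rfl h₁, Finset.sum_add_distrib]
      simp only [Nat.cast_zero, zero_div, zero_mul, add_zero] at h₃
      rw [← h₃]
      simp only [Nat.cast_add, Nat.cast_one, sub_self, zero_div, zero_mul, add_zero] at h₂
      rw [← h₂, ← Finset.sum_add_distrib, Finset.mul_sum]
      refine Finset.sum_congr rfl fun n _ => ?_
      have hchoose : (n : ℝ) * ((n - 1).choose j : ℝ) = ((n : ℝ) - j) * (n.choose j : ℝ) := by
        rcases n with _ | n
        · rw [Nat.choose_eq_zero_of_lt (by omega : 0 < j)]
          simp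
        · rcases le_or_gt j (n + 1) with h | h
          · rw [← Nat.cast_sub h]
            have := Nat.choose_mul_succ_eq n j
            rw [Nat.add_sub_cancel]
            exact_mod_cast (by linarith : (n + 1) * n.choose j = (n + 1 - j) * (n + 1).choose j)
          · rw [Nat.choose_eq_zero_of_lt h, Nat.choose_eq_zero_of_lt (by omega)]
            simp
      linear_combination M (N + 1) n / ((N : ℝ) + 1) * hchoose
    have hchoose : ((N : ℝ) + 1) * (N.choose j : ℝ)
        = ((N : ℝ) + 1 - j) * ((N + 1).choose j : ℝ) := by
      have := Nat.choose_mul_succ_eq N j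
      have h' : (N : ℝ) + 1 - j = ((N + 1 - j : ℕ) : ℝ) := by
        rw [Nat.cast_sub (by omega)]
        push_cast
        ring
      rw [h']
      exact_mod_cast (by linarith : (N + 1) * N.choose j = (N + 1 - j) * (N + 1).choose j)
    rw [hstep] at ih
    have hN1 : (0 : ℝ) < (N : ℝ) + 1 := by positivity
    have hjN : (0 : ℝ) < (N : ℝ) + 1 - j := by
      have : (j : ℝ) ≤ N := by exact_mod_cast hN
      linarith
    rw [div_mul_eq_mul_div, div_eq_iff hN1.ne'] at ih
    apply mul_left_cancel₀ hjN.ne'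
    linear_combination ih + M j j * hchoose

/-- A function on the Pascal triangle satisfying the coherence relation, vanishing on the
diagonal and at `(1, 0)`, vanishes identically. -/
lemma eq_zero_of_coherent_of_diag_eq_zero {D : ℕ → ℕ → ℝ}
    (hcoh : ∀ N : ℕ, 2 ≤ N → ∀ m : ℕ, m ≤ N - 1 →
      (((N : ℝ) - (m : ℝ)) / (N : ℝ)) * D N m + (((m : ℝ) + 1) / (N : ℝ)) * D N (m + 1)
        = D (N - 1) m)
    (h₁ : D 1 0 = 0) (hdiag : ∀ N, 1 ≤ N → D N N = 0) {N : ℕ} (hN : 1 ≤ N) :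
    ∀ n ≤ N, D N n = 0 := by
  induction N, hN using Nat.le_induction with
  | base =>
    intro n hn
    interval_cases n
    exacts [h₁, hdiag 1 le_rfl]
  | succ N hN ih =>
    intro n hn
    induction hn using Nat.decreasingInduction with
    | self => exact hdiag _ (by omega)
    | of_succ n hn ihn =>
      have h := hcoh (N + 1) (by omega) n (by omega)
      rw [Nat.add_sub_cancel, ihn, ih n (by omega), mul_zero, add_zero] at h
      have hn' : (n : ℝ) < ((N + 1 : ℕ) : ℝ) := by exact_mod_cast hn
      refine (mul_eq_zero.1 h).resolve_left (div_pos (by linarith) ?_).ne'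
      positivity

/-- The binomial probabilities satisfy the coherence relation of the Pascal triangle. -/
lemma binomial_coherent (x : ℝ) {N : ℕ} (hN : 2 ≤ N) {m : ℕ} (hm : m ≤ N - 1) :
    (((N : ℝ) - (m : ℝ)) / (N : ℝ)) * ((N.choose m : ℝ) * x ^ m * (1 - x) ^ (N - m))
      + (((m : ℝ) + 1) / (N : ℝ)) *
        ((N.choose (m + 1) : ℝ) * x ^ (m + 1) * (1 - x) ^ (N - (m + 1)))
      = ((N - 1).choose m : ℝ) * x ^ m * (1 - x) ^ (N - 1 - m) := by
  obtain ⟨K, rfl⟩ : ∃ K, N = K + 1 := ⟨N - 1, by omega⟩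
  rw [Nat.add_sub_cancel] at hm ⊢
  obtain ⟨d, rfl⟩ := Nat.exists_eq_add_of_le hm
  have e₁ : m + d + 1 - m = d + 1 := by omega
  have e₂ : m + d + 1 - (m + 1) = d := by omega
  have e₃ : m + d - m = d := by omega
  have h₁ : ((m + d).choose m : ℝ) * ((m : ℝ) + d + 1)
      = ((m + d + 1).choose m : ℝ) * ((d : ℝ) + 1) := by
    have := Nat.choose_mul_succ_eq (m + d) m
    rw [e₁] at this
    exact_mod_cast this
  have h₂ : ((m : ℝ) + d + 1) * ((m + d).choose m : ℝ)
      = ((m + d + 1).choose (m + 1) : ℝ) * ((m : ℝ) + 1) := by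
    exact_mod_cast Nat.add_one_mul_choose_eq (m + d) m
  rw [e₁, e₂, e₃]
  push_cast
  have hK : ((m : ℝ) + d + 1) ≠ 0 := by positivity
  field_simp
  linear_combination x ^ m * (1 - x) ^ d * (-(1 - x) * h₁ - x * h₂)

/-- The image on `[0,1]`, under the map `n ↦ n / N`, of the distribution with weights `w` on
`{0,…,N}`. -/
noncomputable def scaledMeasure (w : ℕ → ℝ) (N : ℕ) : Measure unitInterval :=
  ∑ n ∈ Finset.range (N + 1),
    ENNReal.ofReal (w n) • Measure.dirac (Set.projIcc (0 : ℝ) 1 zero_le_one ((n : ℝ) / N))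

lemma isProbabilityMeasure_scaledMeasure {w : ℕ → ℝ} {N : ℕ} (hpos : ∀ n ≤ N, 0 ≤ w n)
    (hsum : ∑ n ∈ Finset.range (N + 1), w n = 1) : IsProbabilityMeasure (scaledMeasure w N) := by
  constructor
  simp only [scaledMeasure, Measure.coe_finsetSum, Finset.sum_apply, Measure.smul_apply,
    measure_univ, smul_eq_mul, mul_one]
  rw [← ENNReal.ofReal_sum_of_nonneg fun n hn => hpos n (by simpa [Nat.lt_succ_iff] using hn),
    hsum, ENNReal.ofReal_one]

lemma integral_pow_scaledMeasure {w : ℕ → ℝ} {N : ℕ} (hpos : ∀ n ≤ N, 0 ≤ w n) (j : ℕ) :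
    ∫ x, (x : ℝ) ^ j ∂scaledMeasure w N
      = ∑ n ∈ Finset.range (N + 1), w n * ((n : ℝ) / N) ^ j := by
  rw [scaledMeasure, integral_finsetSum_measure]
  · refine Finset.sum_congr rfl fun n hn => ?_
    have hn : n ≤ N := by simpa [Nat.lt_succ_iff] using hn
    have hmem : (n : ℝ) / N ∈ Set.Icc (0 : ℝ) 1 :=
      ⟨by positivity, div_le_one_of_le₀ (by exact_mod_cast hn) (by positivity)⟩
    rw [integral_smul_measure, integral_dirac, Set.projIcc_of_mem _ hmem,
      ENNReal.toReal_ofReal (hpos n hn), smul_eq_mul]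
  · intro n _
    exact (integrable_dirac (by simp)).smul_measure ENNReal.ofReal_ne_top

/-- The moments of the rescaled members of a coherent family converge to its diagonal values. -/
lemma tendsto_integral_pow_scaledMeasure {M : ℕ → ℕ → ℝ}
    (hpos : ∀ N : ℕ, 1 ≤ N → ∀ n : ℕ, n ≤ N → 0 ≤ M N n)
    (hsum : ∀ N : ℕ, 1 ≤ N → ∑ n ∈ Finset.range (N + 1), M N n = 1)
    (hcoh : ∀ N : ℕ, 2 ≤ N → ∀ m : ℕ, m ≤ N - 1 →
      (((N : ℝ) - (m : ℝ)) / (N : ℝ)) * M N m + (((m : ℝ) + 1) / (N : ℝ)) * M N (m + 1)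
        = M (N - 1) m) {j : ℕ} (hj : 1 ≤ j) :
    Tendsto (fun N : ℕ => ∫ x, (x : ℝ) ^ j ∂scaledMeasure (M N) N) atTop (𝓝 (M j j)) := by
  have hlim : Tendsto (fun N : ℕ => (j : ℝ) * ((j : ℝ) / ((N : ℝ) - j))) atTop (𝓝 0) := by
    rw [← mul_zero (j : ℝ)]
    exact (tendsto_const_nhds.div_atTop
      (tendsto_atTop_add_const_right _ (-(j : ℝ)) tendsto_natCast_atTop_atTop)).const_mul _
  rw [tendsto_iff_dist_tendsto_zero]
  refine squeeze_zero' (Eventually.of_forall fun _ => dist_nonneg) ?_ hlim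
  filter_upwards [eventually_gt_atTop j] with N hN
  have hN1 : 1 ≤ N := by omega
  have hC : (0 : ℝ) < N.choose j := by exact_mod_cast Nat.choose_pos hN.le
  have hM : M j j = ∑ n ∈ Finset.range (N + 1), M N n * ((n.choose j : ℝ) / N.choose j) := by
    rw [← mul_div_cancel_right₀ (M j j) hC.ne', ← sum_mul_choose_of_coherent hcoh hj hN.le,
      Finset.sum_div]
    simp only [mul_div_assoc]
  rw [integral_pow_scaledMeasure (hpos N hN1), hM, Real.dist_eq, ← Finset.sum_sub_distrib]
  calc |∑ n ∈ Finset.range (N + 1),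
        (M N n * ((n : ℝ) / N) ^ j - M N n * ((n.choose j : ℝ) / N.choose j))|
      ≤ ∑ n ∈ Finset.range (N + 1), M N n * ((j : ℝ) * ((j : ℝ) / ((N : ℝ) - j))) := by
        refine (Finset.abs_sum_le_sum_abs _ _).trans (Finset.sum_le_sum fun n hn => ?_)
        have hn : n ≤ N := by simpa [Nat.lt_succ_iff] using hn
        rw [← mul_sub, abs_mul, abs_of_nonneg (hpos N hN1 n hn)]
        exact mul_le_mul_of_nonneg_left
          (abs_div_pow_sub_choose_div_choose_le hN hn j le_rfl) (hpos N hN1 n hn)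
    _ = (j : ℝ) * ((j : ℝ) / ((N : ℝ) - j)) := by rw [← Finset.sum_mul, hsum N hN1, one_mul]

/-- The diagonal of a coherent family is the moment sequence of a probability measure. -/
lemma exists_probabilityMeasure_moments_eq {M : ℕ → ℕ → ℝ}
    (hpos : ∀ N : ℕ, 1 ≤ N → ∀ n : ℕ, n ≤ N → 0 ≤ M N n)
    (hsum : ∀ N : ℕ, 1 ≤ N → ∑ n ∈ Finset.range (N + 1), M N n = 1)
    (hcoh : ∀ N : ℕ, 2 ≤ N → ∀ m : ℕ, m ≤ N - 1 →
      (((N : ℝ) - (m : ℝ)) / (N : ℝ)) * M N m + (((m : ℝ) + 1) / (N : ℝ)) * M N (m + 1)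
        = M (N - 1) m) :
    ∃ ν : ProbabilityMeasure unitInterval,
      ∀ j : ℕ, 1 ≤ j → ∫ x, (x : ℝ) ^ j ∂(ν : Measure unitInterval) = M j j := by
  let P (N : ℕ) : ProbabilityMeasure unitInterval := ⟨scaledMeasure (M (N + 1)) (N + 1),
    isProbabilityMeasure_scaledMeasure (hpos (N + 1) (by omega)) (hsum (N + 1) (by omega))⟩
  let U : Ultrafilter ℕ := Ultrafilter.of atTop
  have hU : Tendsto P U (𝓝 (U.map P).lim) := (U.map P).le_nhds_lim
  refine ⟨(U.map P).lim, fun j hj => ?_⟩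
  let f : BoundedContinuousFunction unitInterval ℝ :=
    BoundedContinuousFunction.mkOfCompact ⟨fun x => (x : ℝ) ^ j, by fun_prop⟩
  have h₁ := ProbabilityMeasure.tendsto_iff_forall_integral_tendsto.1 hU f
  have h₂ := ((tendsto_integral_pow_scaledMeasure hpos hsum hcoh hj).comp
    (tendsto_add_atTop_nat 1)).mono_left (Ultrafilter.of_le atTop)
  exact tendsto_nhds_unique h₁ h₂

/-- The boundary of the Pascal triangle is `[0,1]`: any coherent family of probability
distributions `(M_N)` with respect to the Pascal-triangle links is the family of mixtures
of binomial distributions by a unique Borel probability measure `μ` on `[0,1]`. -/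
theorem pascal_triangle_boundary
    (M : ℕ → ℕ → ℝ)
    (hpos : ∀ N : ℕ, 1 ≤ N → ∀ n : ℕ, n ≤ N → 0 ≤ M N n)
    (hsum : ∀ N : ℕ, 1 ≤ N → ∑ n ∈ Finset.range (N + 1), M N n = 1)
    (hcoh : ∀ N : ℕ, 2 ≤ N → ∀ m : ℕ, m ≤ N - 1 →
      (((N : ℝ) - (m : ℝ)) / (N : ℝ)) * M N m + (((m : ℝ) + 1) / (N : ℝ)) * M N (m + 1)
        = M (N - 1) m) :
    ∃! μ : Measure ℝ,
      IsProbabilityMeasure μ ∧ μ (Set.Icc (0 : ℝ) 1)ᶜ = 0 ∧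
      ∀ N : ℕ, 1 ≤ N → ∀ n : ℕ, n ≤ N →
        M N n = ∫ x : ℝ, (N.choose n : ℝ) * x ^ n * (1 - x) ^ (N - n) ∂μ := by
  obtain ⟨ν, hν⟩ := exists_probabilityMeasure_moments_eq hpos hsum hcoh
  have integrable_of_continuous : ∀ {f : unitInterval → ℝ}, Continuous f →
      Integrable f (ν : Measure unitInterval) := fun {f} hf =>
    (BoundedContinuousFunction.mkOfCompact ⟨f, hf⟩).integrable _
  let B (N n : ℕ) : ℝ := ∫ x : unitInterval,
    (N.choose n : ℝ) * (x : ℝ) ^ n * (1 - (x : ℝ)) ^ (N - n) ∂(ν : Measure unitInterval)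
  have hBcoh : ∀ N : ℕ, 2 ≤ N → ∀ m : ℕ, m ≤ N - 1 →
      (((N : ℝ) - (m : ℝ)) / (N : ℝ)) * B N m + (((m : ℝ) + 1) / (N : ℝ)) * B N (m + 1)
        = B (N - 1) m := by
    intro N hN m hm
    simp only [B]
    rw [← integral_const_mul, ← integral_const_mul, ← integral_add
      (integrable_of_continuous (by fun_prop)) (integrable_of_continuous (by fun_prop))]
    exact integral_congr_ae (Eventually.of_forall fun x => binomial_coherent (x : ℝ) hN hm)
  have hBdiag : ∀ N : ℕ, 1 ≤ N → M N N = B N N := by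
    intro N hN
    simp [B, hν N hN]
  have hB10 : M 1 0 = B 1 0 := by
    have h := hsum 1 le_rfl
    have h₁ := hν 1 le_rfl
    have hB : B 1 0 = 1 - ∫ x : unitInterval, (x : ℝ) ^ 1 ∂(ν : Measure unitInterval) := by
      simp only [B, Nat.choose_zero_right, Nat.cast_one, pow_zero, mul_one, one_mul,
        Nat.sub_zero, pow_one]
      rw [integral_sub (integrable_const 1) (integrable_of_continuous (by fun_prop))]
      simp
    rw [Finset.sum_range_succ, Finset.sum_range_one] at h
    linarith
  have hMB : ∀ N : ℕ, 1 ≤ N → ∀ n ≤ N, M N n = B N n := by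
    intro N hN n hn
    refine sub_eq_zero.1 (eq_zero_of_coherent_of_diag_eq_zero (D := fun N n => M N n - B N n)
      (fun N hN m hm => ?_) (sub_eq_zero.2 hB10) (fun N hN => sub_eq_zero.2 (hBdiag N hN))
      hN n hn)
    linear_combination hcoh N hN m hm - hBcoh N hN m hm
  have hval : Measurable (Subtype.val : unitInterval → ℝ) := measurable_subtype_coe
  have hprob : IsProbabilityMeasure ((ν : Measure unitInterval).map Subtype.val) :=
    Measure.isProbabilityMeasure_map hval.aemeasurable
  have hsupp : (ν : Measure unitInterval).map Subtype.val (Set.Icc (0 : ℝ) 1)ᶜ = 0 := by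
    rw [Measure.map_apply hval measurableSet_Icc.compl]
    convert measure_empty (μ := (ν : Measure unitInterval))
    ext x
    simp
  have hrep : ∀ N : ℕ, 1 ≤ N → ∀ n : ℕ, n ≤ N → M N n = ∫ x : ℝ,
      (N.choose n : ℝ) * x ^ n * (1 - x) ^ (N - n) ∂(ν : Measure unitInterval).map Subtype.val := by
    intro N hN n hn
    rw [integral_map hval.aemeasurable
      (by fun_prop : Continuous fun x : ℝ =>
        (N.choose n : ℝ) * x ^ n * (1 - x) ^ (N - n)).aestronglyMeasurable]
    exact hMB N hN n hn
  refine ⟨_, ⟨hprob, hsupp, hrep⟩, fun μ ⟨hμ, hμsupp, hμrep⟩ => ?_⟩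
  refine measure_eq_of_moments_eq hμsupp hsupp fun k => ?_
  rcases Nat.eq_zero_or_pos k with rfl | hk
  · simp
  · have h₁ := hμrep k hk k le_rfl
    have h₂ := hrep k hk k le_rfl
    simp only [Nat.choose_self, Nat.cast_one, one_mul, Nat.sub_self, pow_zero, mul_one] at h₁ h₂
    rw [← h₁, ← h₂]
end

section
/- Intertwining relation for Example 6.B: fix a real number c ∈ [0,1] and an integer N ≥ 2. For K ≥ 1 and F : ℤ → ℝ define (D'_K F)(n) := (K−n)c·[F(n+1)−F(n)] + n(1−c)·[F(n−1)−F(n)], and define (ΛF)(n) := ((N−n)/N)·F(n) + (n/N)·F(n−1). Then for every F : ℤ → ℝ and every integer n with 0 ≤ n ≤ N, one has (D'_N(ΛF))(n) = (Λ(D'_{N−1}F))(n). -/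
/-- The difference operator `D'_K` of Example 6.B:
`(D'_K F)(n) = (K-n)c[F(n+1)-F(n)] + n(1-c)[F(n-1)-F(n)]`. -/
noncomputable def Dop' (c : ℝ) (K : ℕ) (F : ℤ → ℝ) (n : ℤ) : ℝ :=
  ((K : ℝ) - (n : ℝ)) * c * (F (n + 1) - F n)
    + (n : ℝ) * (1 - c) * (F (n - 1) - F n)

/-- Intertwining relation for Example 6.B: for `c ∈ [0,1]`, `N ≥ 2`, any `F : ℤ → ℝ`
and any `0 ≤ n ≤ N`, `(D'_N (ΛF))(n) = (Λ (D'_{N-1} F))(n)`. -/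
theorem pascal_intertwining_deterministic (c : ℝ) (hc0 : 0 ≤ c) (hc1 : c ≤ 1)
    (N : ℕ) (hN : 2 ≤ N) (F : ℤ → ℝ) (n : ℤ) (hn0 : 0 ≤ n) (hnN : n ≤ (N : ℤ)) :
    Dop' c N (Lop N F) n = Lop N (Dop' c (N - 1) F) n := by
  have hN' : (N : ℝ) ≠ 0 := by positivity
  have hK : ((N - 1 : ℕ) : ℝ) = (N : ℝ) - 1 := by
    rw [Nat.cast_sub (by omega), Nat.cast_one]
  simp only [Dop', Lop, hK, add_sub_cancel_right, sub_add_cancel]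
  push_cast
  field_simp
  ring
end

section
/- Existence of the boundary of a projective chain (Theorem 5.A): let (X_N)_{N≥1} be nonempty countable sets, each equipped with the discrete σ-algebra, and for each N ≥ 2 let Λ^N_{N−1} be a Markov kernel from X_N to X_{N−1}. Then there exist a measurable space X_∞ and Markov kernels Λ^∞_N from X_∞ to X_N (N ≥ 1) such that: (a) Λ^∞_N ∘ Λ^N_{N−1} = Λ^∞_{N−1} for all N ≥ 2 (composition of kernels); and (b) the map sending a probability measure M on X_∞ to the sequence (M Λ^∞_N)_{N≥1} is a bijection from the set of probability measures on X_∞ onto the set of coherent families, i.e. sequences (M_N)_{N≥1} of probability measures, M_N on X_N, with M_N Λ^N_{N−1} = M_{N−1} for all N ≥ 2. -/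
open MeasureTheory ProbabilityTheory

namespace ProjectiveChain

open Filter Topology
open scoped ENNReal NNReal

section ReverseMartingale

variable {Ω : Type*} {m0 : MeasurableSpace Ω} {P : Measure Ω}
  {F : ℕ → MeasurableSpace Ω} {f : ℕ → Ω → ℝ}

lemma setIntegral_eq_of_reverse_martingale (hF : Antitone F)
    (hmart : ∀ n A, MeasurableSet[F (n + 1)] A → ∫ ω in A, f n ω ∂P = ∫ ω in A, f (n + 1) ω ∂P)
    {m n : ℕ} (hmn : m ≤ n) {A : Set Ω} (hA : MeasurableSet[F n] A) :
    ∫ ω in A, f m ω ∂P = ∫ ω in A, f n ω ∂P := by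
  induction n, hmn using Nat.le_induction with
  | base => rfl
  | succ n _ ih => rw [ih (hF n.le_succ _ hA), hmart n A hA]

variable [IsProbabilityMeasure P]

lemma integrable_of_reverse_adapted (hle : ∀ n, F n ≤ m0)
    (hf : ∀ n, StronglyMeasurable[F n] (f n)) (hb : ∀ n ω, |f n ω| ≤ 1) (n : ℕ) :
    Integrable (f n) P :=
  .of_bound ((hf n).mono (hle n)).aestronglyMeasurable 1 (.of_forall fun ω => hb n ω)

lemma integral_sq_sub_of_reverse_martingale (hF : Antitone F) (hle : ∀ n, F n ≤ m0)
    (hf : ∀ n, StronglyMeasurable[F n] (f n)) (hb : ∀ n ω, |f n ω| ≤ 1)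
    (hmart : ∀ n A, MeasurableSet[F (n + 1)] A → ∫ ω in A, f n ω ∂P = ∫ ω in A, f (n + 1) ω ∂P)
    {m n : ℕ} (hmn : m ≤ n) :
    ∫ ω, (f m ω - f n ω) ^ 2 ∂P = ∫ ω, f m ω ^ 2 ∂P - ∫ ω, f n ω ^ 2 ∂P := by
  have hint := integrable_of_reverse_adapted (P := P) hle hf hb
  have hmul (i j : ℕ) : Integrable (f i * f j) P := by
    refine .of_bound (((hf i).mono (hle i)).mul ((hf j).mono (hle j))).aestronglyMeasurable 1
      (.of_forall fun ω => ?_)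
    rw [Pi.mul_apply, norm_mul]
    exact mul_le_one₀ (hb i ω) (norm_nonneg _) (hb j ω)
  have hsq (i : ℕ) : Integrable (fun ω => f i ω ^ 2) P := by
    simp only [sq]
    exact hmul i i
  have hce : f n =ᵐ[P] P[f m | F n] :=
    ae_eq_condExp_of_forall_setIntegral_eq (hle n) (hint m) (fun _ _ _ => (hint n).integrableOn)
      (fun s hs _ => (setIntegral_eq_of_reverse_martingale hF hmart hmn hs).symm)
      (hf n).aestronglyMeasurable
  have hcross : ∫ ω, f m ω * f n ω ∂P = ∫ ω, f n ω ^ 2 ∂P := by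
    change ∫ ω, (f m * f n) ω ∂P = _
    rw [← integral_condExp (hle n)]
    refine integral_congr_ae ?_
    filter_upwards [condExp_mul_of_stronglyMeasurable_right (hf n) (hmul m n) (hint m), hce]
      with ω h1 h2
    rw [h1, Pi.mul_apply, ← h2, sq]
  have hcr : Integrable (fun ω => 2 * (f m ω * f n ω)) P := (hmul m n).const_mul 2
  have hdiff : Integrable (fun ω => f m ω ^ 2 - 2 * (f m ω * f n ω)) P := (hsq m).sub hcr
  have : (fun ω => (f m ω - f n ω) ^ 2)
      = fun ω => f m ω ^ 2 - 2 * (f m ω * f n ω) + f n ω ^ 2 := by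
    ext ω; ring
  rw [this, integral_add hdiff (hsq n), integral_sub (hsq m) hcr, integral_const_mul, hcross]
  ring

lemma exists_integral_abs_sub_le_of_reverse_martingale (hF : Antitone F) (hle : ∀ n, F n ≤ m0)
    (hf : ∀ n, StronglyMeasurable[F n] (f n)) (hb : ∀ n ω, |f n ω| ≤ 1)
    (hmart : ∀ n A, MeasurableSet[F (n + 1)] A → ∫ ω in A, f n ω ∂P = ∫ ω in A, f (n + 1) ω ∂P)
    {ε : ℝ} (hε : 0 < ε) :
    ∃ m, ∀ n, m ≤ n → ∫ ω, |f m ω - f n ω| ∂P ≤ ε := by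
  have hint := integrable_of_reverse_adapted (P := P) hle hf hb
  set a : ℕ → ℝ := fun n => ∫ ω, f n ω ^ 2 ∂P
  have hdiff {m n : ℕ} (hmn : m ≤ n) : ∫ ω, (f m ω - f n ω) ^ 2 ∂P = a m - a n :=
    integral_sq_sub_of_reverse_martingale hF hle hf hb hmart hmn
  have hanti : Antitone a := fun m n hmn => by
    have : 0 ≤ ∫ ω, (f m ω - f n ω) ^ 2 ∂P := integral_nonneg fun ω => sq_nonneg _
    linarith [hdiff hmn]
  have hbdd : BddBelow (Set.range a) := by
    refine ⟨0, ?_⟩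
    rintro _ ⟨n, rfl⟩
    exact integral_nonneg fun ω => sq_nonneg _
  have hlim := tendsto_atTop_ciInf hanti hbdd
  obtain ⟨m, hm⟩ := (hlim.eventually_lt_const
    (show iInf a < iInf a + ε ^ 2 by have := pow_pos hε 2; linarith)).exists
  refine ⟨m, fun n hmn => ?_⟩
  have hd : Integrable (fun ω => |f m ω - f n ω|) P := ((hint m).sub (hint n)).abs
  have hd2 : Integrable (fun ω => |f m ω - f n ω| ^ 2) P := by
    refine .of_bound (hd.aestronglyMeasurable.pow 2) 4 (.of_forall fun ω => ?_)
    have h1 := abs_le.1 (hb m ω)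
    have h2 := abs_le.1 (hb n ω)
    rw [Real.norm_eq_abs, sq_abs, abs_of_nonneg (sq_nonneg _)]
    nlinarith
  have hjensen : (∫ ω, |f m ω - f n ω| ∂P) ^ 2 ≤ ∫ ω, |f m ω - f n ω| ^ 2 ∂P :=
    (even_two.convexOn_pow (𝕜 := ℝ)).map_integral_le (continuous_pow 2).continuousOn isClosed_univ
      (by simp) hd hd2
  simp only [sq_abs, hdiff hmn] at hjensen
  have := ciInf_le hbdd n
  exact le_of_sq_le_sq (by linarith) hε.le

lemma maximal_ineq_of_reverse_martingale (hF : Antitone F) (hle : ∀ n, F n ≤ m0)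
    (hf : ∀ n, StronglyMeasurable[F n] (f n)) (hb : ∀ n ω, |f n ω| ≤ 1)
    (hmart : ∀ n A, MeasurableSet[F (n + 1)] A → ∫ ω in A, f n ω ∂P = ∫ ω in A, f (n + 1) ω ∂P)
    {m n : ℕ} (hmn : m ≤ n) (ε : ℝ≥0) :
    ε * P {ω | ∃ N, m ≤ N ∧ N ≤ n ∧ ε ≤ |f N ω - f n ω|}
      ≤ ENNReal.ofReal (∫ ω, |f m ω - f n ω| ∂P) := by
  have hint := integrable_of_reverse_adapted (P := P) hle hf hb
  let 𝒢 : Filtration ℕ m0 :=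
    ⟨fun k => F (n - k), fun i j hij => hF (Nat.sub_le_sub_left hij n), fun k => hle _⟩
  let g : ℕ → Ω → ℝ := fun k ω => f (n - k) ω - f n ω
  have hgint (k : ℕ) : Integrable (g k) P := (hint _).sub (hint n)
  have hg : Martingale g 𝒢 P := by
    refine martingale_of_setIntegral_eq_succ
      (fun k => (hf (n - k)).sub ((hf n).mono (hF (Nat.sub_le n k)))) hgint fun k s hs => ?_
    have h1 : ∫ ω in s, f (n - (k + 1)) ω ∂P = ∫ ω in s, f (n - k) ω ∂P :=
      setIntegral_eq_of_reverse_martingale hF hmart (by omega) hs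
    simp only [g]
    rw [integral_sub (hint _).integrableOn (hint n).integrableOn,
      integral_sub (hint _).integrableOn (hint n).integrableOn, h1]
  have hsub : Submartingale (g ⊔ -g) 𝒢 P := hg.submartingale.sup hg.neg.submartingale
  have habs (k : ℕ) (ω : Ω) : (g ⊔ -g) k ω = |g k ω| := rfl
  have key := maximal_ineq hsub (fun k ω => by rw [habs]; exact abs_nonneg _) (ε := ε) (n - m)
  refine le_trans (mul_le_mul_right (measure_mono ?_) _) (key.trans (ENNReal.ofReal_le_ofReal ?_))
  · rintro ω ⟨N, hmN, hNn, hN⟩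
    refine Finset.le_sup'_of_le (fun k => (g ⊔ -g) k ω) (b := n - N)
      (Finset.mem_range.2 (by omega)) ?_
    rw [habs]
    simpa only [g, Nat.sub_sub_self hNn] using hN
  · simp only [habs, g, Nat.sub_sub_self hmn]
    exact setIntegral_le_integral ((hint m).sub (hint n)).abs (.of_forall fun ω => abs_nonneg _)

/-- A bounded martingale along a decreasing sequence of `σ`-algebras converges almost surely. -/
theorem ae_exists_tendsto_of_reverse_martingale (hF : Antitone F) (hle : ∀ n, F n ≤ m0)
    (hf : ∀ n, StronglyMeasurable[F n] (f n)) (hb : ∀ n ω, |f n ω| ≤ 1)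
    (hmart : ∀ n A, MeasurableSet[F (n + 1)] A → ∫ ω in A, f n ω ∂P = ∫ ω in A, f (n + 1) ω ∂P) :
    ∀ᵐ ω ∂P, ∃ l, Tendsto (fun n => f n ω) atTop (𝓝 l) := by
  have hosc (ε : ℝ≥0) (hε : 0 < ε) :
      ∀ᵐ ω ∂P, ∃ m, ∀ N, m ≤ N → ∀ n, N ≤ n → |f N ω - f n ω| < ε := by
    rw [ae_iff]
    push Not
    set bad : Set Ω := {ω | ∀ m, ∃ N, m ≤ N ∧ ∃ n, N ≤ n ∧ (ε : ℝ) ≤ |f N ω - f n ω|}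
    have hbound (η : ℝ) (hη : 0 < η) : ((ε / 2 : ℝ≥0) : ℝ≥0∞) * P bad ≤ ENNReal.ofReal η := by
      obtain ⟨m, hm⟩ := exists_integral_abs_sub_le_of_reverse_martingale hF hle hf hb hmart hη
      let E : ℕ → Set Ω := fun n =>
        {ω | ∃ N N', m ≤ N ∧ N ≤ N' ∧ N' ≤ n ∧ (ε : ℝ) ≤ |f N ω - f N' ω|}
      have hE : Monotone E := by
        rintro i j hij ω ⟨N, N', h1, h2, h3, h4⟩
        exact ⟨N, N', h1, h2, h3.trans hij, h4⟩
      have hsub : bad ⊆ ⋃ n, E n := by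
        intro ω hω
        obtain ⟨N, h1, n, h2, h3⟩ := hω m
        exact Set.mem_iUnion.2 ⟨n, N, n, h1, h2, le_rfl, h3⟩
      refine (mul_le_mul_right (measure_mono hsub) _).trans ?_
      rw [hE.measure_iUnion, ENNReal.mul_iSup]
      refine iSup_le fun n => ?_
      rcases lt_or_ge n m with hnm | hmn
      · have : E n = ∅ := by
          ext ω
          simp only [Set.mem_empty_iff_false, iff_false]
          rintro ⟨N, N', h1, h2, h3, -⟩
          omega
        simp [this]
      · refine (mul_le_mul_right (measure_mono ?_) _).trans
          ((maximal_ineq_of_reverse_martingale hF hle hf hb hmart hmn (ε / 2)).trans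
            (ENNReal.ofReal_le_ofReal (hm n hmn)))
        rintro ω ⟨N, N', h1, h2, h3, h4⟩
        have htri := abs_sub_le (f N ω) (f n ω) (f N' ω)
        rw [abs_sub_comm (f n ω)] at htri
        have h2ε : ((ε / 2 : ℝ≥0) : ℝ) = ε / 2 := by simp
        by_cases hN : ((ε / 2 : ℝ≥0) : ℝ) ≤ |f N ω - f n ω|
        · exact ⟨N, h1, h2.trans h3, hN⟩
        · exact ⟨N', h1.trans h2, h3, by rw [h2ε] at hN ⊢; linarith⟩
    have hzero : ((ε / 2 : ℝ≥0) : ℝ≥0∞) * P bad ≤ 0 :=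
      ENNReal.le_of_forall_pos_le_add fun η hη _ => by
        simpa using hbound η (by exact_mod_cast hη)
    have hε2 : ((ε / 2 : ℝ≥0) : ℝ≥0∞) ≠ 0 := by
      have : ε / 2 ≠ 0 := by positivity
      exact_mod_cast this
    exact (mul_eq_zero.1 (nonpos_iff_eq_zero.1 hzero)).resolve_left hε2
  have hall : ∀ᵐ ω ∂P, ∀ j : ℕ, ∃ m, ∀ N, m ≤ N → ∀ n, N ≤ n →
      |f N ω - f n ω| < ((1 / ((j : ℝ≥0) + 1) : ℝ≥0) : ℝ) :=
    ae_all_iff.2 fun j => hosc _ (by positivity)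
  filter_upwards [hall] with ω hω
  refine cauchySeq_tendsto_of_complete (Metric.cauchySeq_iff'.2 fun δ hδ => ?_)
  obtain ⟨j, hj⟩ := exists_nat_one_div_lt hδ
  obtain ⟨m, hm⟩ := hω j
  refine ⟨m, fun n hn => ?_⟩
  rw [dist_comm, Real.dist_eq]
  exact (hm m le_rfl n hn).trans (by simpa using hj)

end ReverseMartingale

variable {X : ℕ → Type}

/-- The paths which agree with `x` at all levels from `n` to `m`. -/
def window (n m : ℕ) (x : Π i, X i) : Set (Π i, X i) :=
  {ω | ∀ i, n ≤ i → i ≤ m → ω i = x i}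

/-- The probability of descending from level `m` to level `n` along the path `x`. -/
noncomputable def weight (p : ∀ n, X (n + 1) → X n → ℝ≥0∞) (n m : ℕ) (x : Π i, X i) : ℝ≥0∞ :=
  ∏ i ∈ Finset.Ico n m, p i (x (i + 1)) (x i)

/-- Coherent families of probability weights for the transition weights `p`. -/
structure IsCoherent (p : ∀ n, X (n + 1) → X n → ℝ≥0∞) (s : ∀ n, X n → ℝ≥0∞) : Prop where
  tsum_eq_one : ∀ n, ∑' x, s n x = 1
  tsum_mul_eq : ∀ n x, ∑' y, s (n + 1) y * p n y x = s n x

/-- The `σ`-algebra of events depending on the levels `≥ n`. -/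
abbrev tailFrom (X : ℕ → Type) (n : ℕ) : MeasurableSpace (Π i, X i) :=
  .generateFrom {A | ∃ m x, n ≤ m ∧ window n m x = A}

lemma mem_window_self (n m : ℕ) (x : Π i, X i) : x ∈ window n m x := fun _ _ _ => rfl

lemma window_eq_of_mem {n m : ℕ} {x ω : Π i, X i} (h : ω ∈ window n m x) :
    window n m x = window n m ω := by
  ext η
  exact forall_congr' fun i => forall_congr' fun h1 => forall_congr' fun h2 => by rw [h i h1 h2]

lemma window_inter_window_self (n m m' : ℕ) (ω : Π i, X i) :
    window n m ω ∩ window n m' ω = window n (max m m') ω := by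
  ext η
  refine ⟨fun h i h1 h2 => ?_, fun h => ⟨fun i h1 h2 => h i h1 (h2.trans (le_max_left _ _)),
    fun i h1 h2 => h i h1 (h2.trans (le_max_right _ _))⟩⟩
  rcases le_max_iff.1 h2 with h2 | h2
  exacts [h.1 i h1 h2, h.2 i h1 h2]

lemma isPiSystem_window (n : ℕ) :
    IsPiSystem {A : Set (Π i, X i) | ∃ m x, n ≤ m ∧ window n m x = A} := by
  rintro _ ⟨m, x, hm, rfl⟩ _ ⟨m', y, hm', rfl⟩ ⟨ω, h1, h2⟩
  exact ⟨max m m', ω, le_max_of_le_left hm,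
    by rw [window_eq_of_mem h1, window_eq_of_mem h2, window_inter_window_self]⟩

lemma measurableSet_tailFrom_window {n m : ℕ} (hnm : n ≤ m) (x : Π i, X i) :
    MeasurableSet[tailFrom X n] (window n m x) :=
  MeasurableSpace.measurableSet_generateFrom ⟨m, x, hnm, rfl⟩

lemma weight_congr {p : ∀ n, X (n + 1) → X n → ℝ≥0∞} {n m : ℕ} {x y : Π i, X i}
    (h : ∀ i, n ≤ i → i ≤ m → x i = y i) : weight p n m x = weight p n m y := by
  refine Finset.prod_congr rfl fun i hi => ?_
  rw [Finset.mem_Ico] at hi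
  rw [h i hi.1 hi.2.le, h (i + 1) (by omega) (by omega)]

lemma weight_mul_weight (p : ∀ n, X (n + 1) → X n → ℝ≥0∞) {n m k : ℕ} (hnm : n ≤ m) (hmk : m ≤ k)
    (x : Π i, X i) : weight p n m x * weight p m k x = weight p n k x :=
  Finset.prod_Ico_consecutive _ hnm hmk

lemma weight_self (p : ∀ n, X (n + 1) → X n → ℝ≥0∞) (n : ℕ) (x : Π i, X i) :
    weight p n n x = 1 := by
  simp [weight]

lemma weight_succ_right (p : ∀ n, X (n + 1) → X n → ℝ≥0∞) {n m : ℕ} (hnm : n ≤ m) (x : Π i, X i) :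
    weight p n (m + 1) x = weight p n m x * p m (x (m + 1)) (x m) :=
  Finset.prod_Ico_succ_top hnm _

lemma weight_succ_left (p : ∀ n, X (n + 1) → X n → ℝ≥0∞) {n m : ℕ} (hnm : n < m) (x : Π i, X i) :
    weight p n m x = p n (x (n + 1)) (x n) * weight p (n + 1) m x :=
  Finset.prod_eq_prod_Ico_succ_bot hnm _

section Measurability

variable [∀ n, Countable (X n)] [∀ n, Nonempty (X n)]

/-- There are only countably many windows from `n` to `m`. -/
lemma countable_range_window (n m : ℕ) : (Set.range (window (X := X) n m)).Countable := by
  let r : (Π i, X i) → Π i : Finset.Iic m, X i := fun x i => x i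
  have hr : ∀ x y, r x = r y → window n m x = window n m y := fun x y h =>
    window_eq_of_mem fun i _ hi => (congrFun h ⟨i, Finset.mem_Iic.2 hi⟩).symm
  have : Set.range (window (X := X) n m)
      = (fun u => window n m (Function.invFun r u)) '' Set.range r := by
    rw [← Set.range_comp]
    congr 1
    ext1 x
    exact (hr _ _ (Function.invFun_eq ⟨x, rfl⟩)).symm
  rw [this]
  exact (Set.to_countable _).image _

lemma measurableSet_tailFrom_eval {n i : ℕ} (hni : n ≤ i) (B : Set (X i)) :
    MeasurableSet[tailFrom X n] {ω : Π i, X i | ω i ∈ B} := by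
  have : {ω : Π i, X i | ω i ∈ B}
      = ⋃₀ (Set.range (window n i) ∩ {A | A ⊆ {ω | ω i ∈ B}}) := by
    ext ω
    refine ⟨fun h => ⟨window n i ω, ⟨⟨ω, rfl⟩, fun η hη => ?_⟩, mem_window_self n i ω⟩,
      fun ⟨A, ⟨_, hA⟩, hω⟩ => hA hω⟩
    rw [Set.mem_ofPred_eq, hη i hni le_rfl]
    exact h
  rw [this]
  refine MeasurableSet.sUnion ((countable_range_window n i).mono Set.inter_subset_left) ?_
  rintro _ ⟨⟨x, rfl⟩, -⟩
  exact measurableSet_tailFrom_window hni x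

lemma antitone_tailFrom : Antitone (tailFrom X) := by
  intro n n' h
  refine MeasurableSpace.generateFrom_le ?_
  rintro _ ⟨m, x, hm, rfl⟩
  have : window n' m x = ⋂ i ∈ Finset.Icc n' m, {ω : Π i, X i | ω i ∈ ({x i} : Set (X i))} := by
    ext ω
    simp [window, Finset.mem_Icc]
  rw [this]
  exact Finset.measurableSet_biInter _ fun i hi =>
    measurableSet_tailFrom_eval (h.trans (Finset.mem_Icc.1 hi).1) _

variable [∀ n, MeasurableSpace (X n)]

lemma measurable_tailFrom_eval {n i : ℕ} (hni : n ≤ i) :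
    Measurable[tailFrom X n] (fun ω : Π i, X i => ω i) :=
  fun B _ => measurableSet_tailFrom_eval hni B

variable [∀ n, DiscreteMeasurableSpace (X n)]

omit [∀ n, Countable (X n)] [∀ n, Nonempty (X n)] in
lemma measurableSet_window (n m : ℕ) (x : Π i, X i) : MeasurableSet (window n m x) := by
  have : window n m x = ⋂ i ∈ Finset.Icc n m, {ω : Π i, X i | ω i ∈ ({x i} : Set (X i))} := by
    ext ω
    simp [window, Finset.mem_Icc]
  rw [this]
  exact Finset.measurableSet_biInter _ fun i _ => measurable_pi_apply i (.of_discrete)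

lemma tailFrom_zero : tailFrom X 0 = MeasurableSpace.pi := by
  refine le_antisymm (MeasurableSpace.generateFrom_le ?_) (iSup_le fun i => ?_)
  · rintro _ ⟨m, x, -, rfl⟩
    exact measurableSet_window 0 m x
  · exact (measurable_tailFrom_eval (X := X) (Nat.zero_le i)).comap_le

lemma tailFrom_le (n : ℕ) : tailFrom X n ≤ MeasurableSpace.pi :=
  tailFrom_zero (X := X) ▸ antitone_tailFrom (Nat.zero_le n)

end Measurability

section Ext

variable [∀ n, Countable (X n)] [∀ n, MeasurableSpace (X n)] [∀ n, DiscreteMeasurableSpace (X n)]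

lemma measure_eq_tsum_inter_eval (μ : Measure (Π i, X i)) (n : ℕ) {A : Set (Π i, X i)}
    (hA : MeasurableSet A) : μ A = ∑' z, μ ({ω | ω n = z} ∩ A) := by
  rw [← measure_iUnion]
  · congr 1
    ext ω
    simp
  · intro z w hzw
    refine Set.disjoint_left.2 ?_
    rintro ω ⟨h1, -⟩ ⟨h2, -⟩
    exact hzw (h1.symm.trans h2)
  · exact fun z => (measurable_pi_apply n (.of_discrete : MeasurableSet {z})).inter hA

lemma measure_eq_of_window [∀ n, Nonempty (X n)] {μ ν : Measure (Π i, X i)} [IsFiniteMeasure μ]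
    {n : ℕ} (h : ∀ m x, n ≤ m → μ (window n m x) = ν (window n m x)) {A : Set (Π i, X i)}
    (hA : MeasurableSet[tailFrom X n] A) : μ A = ν A := by
  refine ext_on_measurableSpace_of_generate_finite MeasurableSpace.pi
    {A | ∃ m x, n ≤ m ∧ window n m x = A} ?_ (tailFrom_le n) rfl (isPiSystem_window n) ?_ hA
  · rintro _ ⟨m, x, hm, rfl⟩
    exact h m x hm
  · rw [measure_eq_tsum_inter_eval μ n .univ, measure_eq_tsum_inter_eval ν n .univ]
    refine tsum_congr fun z => ?_
    have : {ω : Π i, X i | ω n = z} ∩ Set.univ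
        = window n n (Function.update (fun _ => Classical.arbitrary _) n z) := by
      ext ω
      refine ⟨fun h i h1 h2 => ?_, fun h => ⟨by simpa using h n le_rfl le_rfl, trivial⟩⟩
      obtain rfl : i = n := le_antisymm h2 h1
      simpa using h.1
    rw [this, h n _ le_rfl]

lemma setLIntegral_comp_eval (μ : Measure (Π i, X i)) (n : ℕ) (g : X n → ℝ≥0∞)
    (A : Set (Π i, X i)) :
    ∫⁻ ω in A, g (ω n) ∂μ = ∑' z, g z * μ ({ω | ω n = z} ∩ A) := by
  rw [← lintegral_map (f := g) (g := fun ω : Π i, X i => ω n) (.of_discrete)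
    (measurable_pi_apply n), lintegral_countable']
  refine tsum_congr fun z => ?_
  have hz : MeasurableSet {ω : Π i, X i | ω n = z} :=
    measurable_pi_apply n (.of_discrete : MeasurableSet {z})
  rw [Measure.map_apply (measurable_pi_apply n) .of_discrete, ← Measure.restrict_apply hz]
  rfl

end Ext

section OfWeights

variable {α : Type*} [MeasurableSpace α]

/-- The measure on a discrete space with prescribed point masses. -/
noncomputable def ofWeights (w : α → ℝ≥0∞) : Measure α :=
  Measure.sum fun x => w x • Measure.dirac x

lemma ofWeights_singleton [MeasurableSingletonClass α] (w : α → ℝ≥0∞) (x : α) :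
    ofWeights w {x} = w x := by
  rw [ofWeights, Measure.sum_apply _ (measurableSet_singleton x), tsum_eq_single x]
  · simp
  · intro y hy
    simp [hy]

lemma isProbabilityMeasure_ofWeights {w : α → ℝ≥0∞} (hw : ∑' x, w x = 1) :
    IsProbabilityMeasure (ofWeights w) :=
  ⟨by simp [ofWeights, Measure.sum_apply _ MeasurableSet.univ, hw]⟩

lemma measurable_ofWeights [Countable α] : Measurable (ofWeights (α := α)) := by
  refine Measure.measurable_of_measurable_coe _ fun B hB => ?_
  simp only [ofWeights, Measure.sum_apply _ hB, Measure.smul_apply, smul_eq_mul]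
  exact Measurable.tsum fun x => (measurable_pi_apply x).mul_const _

end OfWeights

/-- The law of a path whose level `n` marginals are `s n` and which descends according to `p`. -/
structure IsPathLaw [∀ n, MeasurableSpace (X n)] (p : ∀ n, X (n + 1) → X n → ℝ≥0∞)
    (s : ∀ n, X n → ℝ≥0∞) (P : Measure (Π i, X i)) : Prop where
  isProbabilityMeasure : IsProbabilityMeasure P
  measure_window : ∀ m x, P (window 0 m x) = s m (x m) * weight p 0 m x

variable [∀ n, MeasurableSpace (X n)] {p : ∀ n, X (n + 1) → X n → ℝ≥0∞} {s : ∀ n, X n → ℝ≥0∞}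
  {P : Measure (Π i, X i)}

omit [∀ n, MeasurableSpace (X n)] in
lemma IsCoherent.ne_top (hs : IsCoherent p s) (n : ℕ) (x : X n) : s n x ≠ ∞ :=
  ne_top_of_le_ne_top ENNReal.one_ne_top ((ENNReal.le_tsum x).trans_eq (hs.tsum_eq_one n))

section Existence

open Kernel Preorder

lemma trajMeasure_map_eval_zero (μ₀ : Measure (X 0)) [IsProbabilityMeasure μ₀]
    (κ : (n : ℕ) → Kernel (Π i : Finset.Iic n, X i) (X (n + 1))) [∀ n, IsMarkovKernel (κ n)] :
    (trajMeasure μ₀ κ).map (fun ω => ω 0) = μ₀ := by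
  have h : (trajMeasure μ₀ κ).map (frestrictLe 0) = μ₀.map (MeasurableEquiv.piUnique _).symm := by
    rw [trajMeasure, Measure.map_comp _ _ (by fun_prop), traj_map_frestrictLe, partialTraj_self,
      Measure.id_comp]
  have heval : Measurable fun u : (Π i : Finset.Iic 0, X i) => u ⟨0, Finset.mem_Iic.2 le_rfl⟩ :=
    measurable_pi_apply _
  have h' := congrArg (Measure.map fun u => u ⟨0, Finset.mem_Iic.2 le_rfl⟩) h
  rw [Measure.map_map heval (by fun_prop)] at h'
  exact h'.trans ((Measure.map_map heval (MeasurableEquiv.measurable _)).trans Measure.map_id)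

variable [∀ n, DiscreteMeasurableSpace (X n)] [∀ n, Countable (X n)]

lemma IsCoherent.exists_isPathLaw [∀ n, Nonempty (X n)] (hs : IsCoherent p s) :
    ∃ P, IsPathLaw p s P := by
  classical
  have hex (n : ℕ) (x : X n) : ∃ ν : Measure (X (n + 1)), IsProbabilityMeasure ν ∧
      ∀ y, s n x * ν {y} = s (n + 1) y * p n y x := by
    have hx := hs.tsum_mul_eq n x
    by_cases h0 : s n x = 0
    · refine ⟨Measure.dirac (Classical.arbitrary _), inferInstance, fun y => ?_⟩
      rw [h0, zero_mul]
      rw [h0, ENNReal.tsum_eq_zero] at hx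
      exact (hx y).symm
    · refine ⟨ofWeights fun y => (s n x)⁻¹ * (s (n + 1) y * p n y x),
        isProbabilityMeasure_ofWeights ?_, fun y => ?_⟩
      · rw [ENNReal.tsum_mul_left, hx, ENNReal.inv_mul_cancel h0 (hs.ne_top n x)]
      · rw [ofWeights_singleton, ← mul_assoc, ENNReal.mul_inv_cancel h0 (hs.ne_top n x), one_mul]
  choose ν hν hνs using hex
  let κ (n : ℕ) : Kernel (Π i : Finset.Iic n, X i) (X (n + 1)) :=
    (Kernel.ofFunOfCountable (ν n)).comap (fun u => u ⟨n, Finset.mem_Iic.2 le_rfl⟩)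
      (measurable_pi_apply _)
  have hκ (n : ℕ) : IsMarkovKernel (κ n) := ⟨fun u => hν n _⟩
  have := isProbabilityMeasure_ofWeights (hs.tsum_eq_one 0)
  have hpre (m : ℕ) (x : Π i, X i) : frestrictLe m ⁻¹' {frestrictLe m x} = window 0 m x := by
    ext ω
    simp only [Set.mem_preimage, Set.mem_singleton_iff, funext_iff, window, Set.mem_ofPred_eq]
    exact ⟨fun h i _ hi => h ⟨i, Finset.mem_Iic.2 hi⟩,
      fun h i => h i (Nat.zero_le _) (Finset.mem_Iic.1 i.2)⟩
  refine ⟨trajMeasure (ofWeights (s 0)) κ, inferInstance, fun m x => ?_⟩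
  have hmeas (m : ℕ) : Measurable (frestrictLe (π := X) m) := by fun_prop
  induction m with
  | zero =>
    have hset : window 0 0 x = (fun ω => ω 0) ⁻¹' {x 0} := by
      ext ω
      refine ⟨fun h => h 0 le_rfl le_rfl, fun h i _ hi => ?_⟩
      obtain rfl := Nat.le_zero.1 hi
      exact h
    rw [hset, ← Measure.map_apply (measurable_pi_apply 0) (measurableSet_singleton _),
      trajMeasure_map_eval_zero, weight_self, mul_one, ofWeights_singleton]
  | succ m ih =>
    have hset : window 0 (m + 1) x = (fun ω : Π i, X i => (frestrictLe m ω, ω (m + 1))) ⁻¹'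
        ({frestrictLe m x} ×ˢ {x (m + 1)}) := by
      rw [Set.mk_preimage_prod, hpre]
      ext ω
      simp only [Set.mem_inter_iff, Set.mem_preimage, Set.mem_singleton_iff]
      refine ⟨fun h => ⟨fun i h1 h2 => h i h1 (by omega), h _ (by omega) le_rfl⟩,
        fun h i h1 h2 => ?_⟩
      rcases h2.lt_or_eq with h2 | rfl
      exacts [h.1 i h1 (by omega), h.2]
    rw [hset, ← Measure.map_apply (by fun_prop)
      ((measurableSet_singleton _).prod (measurableSet_singleton _)),
      ← map_frestrictLe_trajMeasure_compProd_eq_map_trajMeasure,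
      Measure.compProd_apply_prod (measurableSet_singleton _) (measurableSet_singleton _),
      lintegral_singleton, Measure.map_apply (hmeas m) (measurableSet_singleton _), hpre, ih]
    change ν m (x m) {x (m + 1)} * _ = _
    rw [weight_succ_right p (Nat.zero_le m), mul_comm, mul_right_comm, hνs]
    ring

end Existence

section PathLaw

omit [∀ n, MeasurableSpace (X n)] in
lemma eval_inter_window {n m : ℕ} (hnm : n < m) (x : Π i, X i) (z : X n) :
    {ω | ω n = z} ∩ window (n + 1) m x = window n m (Function.update x n z) := by
  ext ω
  constructor
  · rintro ⟨h1, h2⟩ i hi1 hi2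
    rcases hi1.eq_or_lt with rfl | hi1
    · simpa using h1
    · rw [Function.update_of_ne hi1.ne']
      exact h2 i hi1 hi2
  · intro h
    refine ⟨by simpa using h n le_rfl hnm.le, fun i hi1 hi2 => ?_⟩
    rw [h i (by omega) hi2, Function.update_of_ne (by omega)]

variable [∀ n, DiscreteMeasurableSpace (X n)] [∀ n, Countable (X n)]

lemma IsPathLaw.measure_window_of_le (hP : IsPathLaw p s P) (hp : ∀ n y, ∑' x, p n y x = 1)
    {n m : ℕ} (hnm : n ≤ m) (x : Π i, X i) :
    P (window n m x) = s m (x m) * weight p n m x := by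
  induction n generalizing x with
  | zero => exact hP.measure_window m x
  | succ n ih =>
    have hlt : n < m := hnm
    have hterm (z : X n) : P ({ω | ω n = z} ∩ window (n + 1) m x)
        = s m (x m) * weight p (n + 1) m x * p n (x (n + 1)) z := by
      rw [eval_inter_window hlt, ih hlt.le, weight_succ_left p hlt, Function.update_self,
        Function.update_of_ne (by omega), Function.update_of_ne (by omega),
        weight_congr (x := Function.update x n z) (y := x)
          fun i h _ => Function.update_of_ne (by omega) _ _]
      ring
    rw [measure_eq_tsum_inter_eval P n (measurableSet_window _ _ _)]
    simp only [hterm]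
    rw [ENNReal.tsum_mul_left, hp, mul_one]

variable [∀ n, Nonempty (X n)]

lemma IsPathLaw.measure_eval_inter (hP : IsPathLaw p s P) (hp : ∀ n y, ∑' x, p n y x = 1)
    {n : ℕ} (z : X n) {A : Set (Π i, X i)} (hA : MeasurableSet[tailFrom X (n + 1)] A) :
    P ({ω | ω n = z} ∩ A) = ∫⁻ ω in A, p n (ω (n + 1)) z ∂P := by
  have := hP.isProbabilityMeasure
  have hA' := tailFrom_le _ A hA
  rw [Set.inter_comm, ← Measure.restrict_apply hA', ← withDensity_apply _ hA']
  refine measure_eq_of_window (fun m x hm => ?_) hA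
  have hW := measurableSet_window (n + 1) m x
  rw [Measure.restrict_apply hW, withDensity_apply _ hW, Set.inter_comm, eval_inter_window hm,
    hP.measure_window_of_le hp (Nat.le_of_succ_le hm), weight_succ_left p hm, Function.update_self,
    Function.update_of_ne (by omega), Function.update_of_ne (by omega),
    weight_congr (x := Function.update x n z) (y := x)
      fun i h _ => Function.update_of_ne (by omega) _ _]
  have hc : ∀ ω ∈ window (n + 1) m x, p n (ω (n + 1)) z = p n (x (n + 1)) z := fun ω hω => by
    rw [hω (n + 1) le_rfl hm]
  rw [setLIntegral_congr_fun hW hc, setLIntegral_const, hP.measure_window_of_le hp hm]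
  ring

lemma IsPathLaw.measure_window_inter (hP : IsPathLaw p s P) (hp : ∀ n y, ∑' x, p n y x = 1)
    {n : ℕ} (x : Π i, X i) {A : Set (Π i, X i)} (hA : MeasurableSet[tailFrom X n] A) :
    P (window 0 n x ∩ A) = weight p 0 n x * P ({ω | ω n = x n} ∩ A) := by
  have := hP.isProbabilityMeasure
  have hA' := tailFrom_le _ A hA
  rw [Set.inter_comm, Set.inter_comm {ω : Π i, X i | ω n = x n}, ← Measure.restrict_apply hA',
    ← Measure.restrict_apply hA', ← smul_eq_mul, ← Measure.smul_apply]
  refine measure_eq_of_window (fun m y hm => ?_) hA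
  have hW := measurableSet_window n m y
  rw [Measure.restrict_apply hW, Measure.smul_apply, Measure.restrict_apply hW, smul_eq_mul]
  by_cases hxy : x n = y n
  · let g : Π i, X i := fun i => if i ≤ n then x i else y i
    have hgx : ∀ i, i ≤ n → g i = x i := fun i hi => if_pos hi
    have hgy : ∀ i, n ≤ i → g i = y i := fun i hi => by
      rcases hi.eq_or_lt with rfl | hi
      · rw [hgx n le_rfl, hxy]
      · exact if_neg (by omega)
    have h1 : window n m y ∩ window 0 n x = window 0 m g := by
      ext ω
      constructor
      · rintro ⟨h1, h2⟩ i hi1 hi2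
        rcases le_total i n with hi | hi
        · rw [hgx i hi, h2 i hi1 hi]
        · rw [hgy i hi, h1 i hi hi2]
      · exact fun h => ⟨fun i hi1 hi2 => by rw [h i (Nat.zero_le _) hi2, hgy i hi1],
          fun i hi1 hi2 => by rw [h i hi1 (hi2.trans hm), hgx i hi2]⟩
    have h2 : window n m y ∩ {ω | ω n = x n} = window n m g := by
      ext ω
      constructor
      · rintro ⟨h1, -⟩ i hi1 hi2
        rw [hgy i hi1, h1 i hi1 hi2]
      · exact fun h => ⟨fun i hi1 hi2 => by rw [h i hi1 hi2, hgy i hi1],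
          by rw [Set.mem_ofPred_eq, h n le_rfl hm, hgx n le_rfl]⟩
    rw [h1, h2, hP.measure_window, hP.measure_window_of_le hp hm,
      ← weight_mul_weight p (Nat.zero_le n) hm,
      weight_congr (x := g) (y := x) fun i _ hi => hgx i hi]
    ring
  · have h1 : window n m y ∩ window 0 n x = ∅ := by
      ext ω
      simp only [Set.mem_inter_iff, Set.mem_empty_iff_false, iff_false]
      rintro ⟨h1, h2⟩
      exact hxy ((h2 n (Nat.zero_le n) le_rfl).symm.trans (h1 n le_rfl hm))
    have h2 : window n m y ∩ {ω | ω n = x n} = ∅ := by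
      ext ω
      simp only [Set.mem_inter_iff, Set.mem_empty_iff_false, iff_false]
      rintro ⟨h1, h2⟩
      exact hxy (h2.symm.trans (h1 n le_rfl hm))
    rw [h1, h2, measure_empty, mul_zero]

end PathLaw

/-- The probability of descending from `y` at level `k + j` to `z` at level `k`. -/
noncomputable def descend (p : ∀ n, X (n + 1) → X n → ℝ≥0∞) (k : ℕ) (z : X k) :
    ∀ j, X (k + j) → ℝ≥0∞
  | 0 => Set.indicator {z} 1
  | j + 1 => fun y => ∑' w, p (k + j) y w * descend p k z j w

/-- The weights seen from the boundary point towards which the path `ω` converges. -/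
noncomputable def limitWeights (p : ∀ n, X (n + 1) → X n → ℝ≥0∞) (ω : Π i, X i) (k : ℕ)
    (z : X k) : ℝ≥0∞ :=
  limsup (fun j => descend p k z j (ω (k + j))) atTop

omit [∀ n, MeasurableSpace (X n)] in
lemma descend_le_one (hp : ∀ n y, ∑' x, p n y x = 1) (k : ℕ) (z : X k) (j : ℕ) (y : X (k + j)) :
    descend p k z j y ≤ 1 := by
  induction j with
  | zero => exact Set.indicator_le_self' (fun _ _ => zero_le) y
  | succ j ih =>
    calc ∑' w, p (k + j) y w * descend p k z j w ≤ ∑' w, p (k + j) y w :=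
          ENNReal.tsum_le_tsum fun w => mul_le_of_le_one_right zero_le (ih w)
      _ = 1 := hp _ _

lemma measurable_tsum_ennreal {Ω ι : Type*} [Countable ι] {m : MeasurableSpace Ω}
    {f : ι → Ω → ℝ≥0∞} (hf : ∀ i, Measurable[m] (f i)) : Measurable[m] fun ω => ∑' i, f i ω :=
  Measurable.tsum hf

lemma ae_eq_of_forall_setLIntegral_eq_of_le {Ω : Type*} {m m0 : MeasurableSpace Ω} (hm : m ≤ m0)
    {μ : Measure Ω} [IsFiniteMeasure μ] {f g : Ω → ℝ≥0∞} (hf : Measurable[m] f)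
    (hg : Measurable[m] g)
    (h : ∀ A, MeasurableSet[m] A → ∫⁻ ω in A, f ω ∂μ = ∫⁻ ω in A, g ω ∂μ) : f =ᵐ[μ] g := by
  refine ae_eq_of_ae_eq_trim (hm := hm)
    (ae_eq_of_forall_setLIntegral_eq_of_sigmaFinite hf hg fun A hA _ => ?_)
  rw [restrict_trim hm μ hA, lintegral_trim hm hf, lintegral_trim hm hg]
  exact h A hA

section Limit

variable [∀ n, Countable (X n)] [∀ n, Nonempty (X n)] [∀ n, DiscreteMeasurableSpace (X n)]

lemma measurable_tailFrom_limitWeights (n k : ℕ) (z : X k) :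
    Measurable[tailFrom X n] (fun ω : Π i, X i => limitWeights p ω k z) := by
  have h (ω : Π i, X i) : limitWeights p ω k z
      = limsup (fun j => descend p k z (j + n) (ω (k + (j + n)))) atTop :=
    (limsup_nat_add (fun j => descend p k z j (ω (k + j))) n).symm
  simp only [h]
  refine Measurable.limsup fun j => ?_
  exact (Measurable.of_discrete (f := descend p k z (j + n))).comp
    (measurable_tailFrom_eval (by omega))

lemma measurable_limitWeights : Measurable (limitWeights p) := by
  refine measurable_pi_lambda _ fun k => measurable_pi_lambda _ fun z => ?_
  rw [← tailFrom_zero]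
  exact measurable_tailFrom_limitWeights 0 k z

lemma measurable_limitWeights_apply (k : ℕ) (z : X k) :
    Measurable fun ω => limitWeights p ω k z :=
  ((measurable_pi_apply z).comp (measurable_pi_apply k)).comp measurable_limitWeights

/-- The `σ`-algebra of tail events. -/
abbrev tail (X : ℕ → Type) : MeasurableSpace (Π i, X i) := ⨅ n, tailFrom X n

omit [∀ n, MeasurableSpace (X n)] [∀ n, Countable (X n)] [∀ n, Nonempty (X n)]
  [∀ n, DiscreteMeasurableSpace (X n)] in
lemma measurableSet_tail {A : Set (Π i, X i)} :
    MeasurableSet[tail X] A ↔ ∀ n, MeasurableSet[tailFrom X n] A :=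
  MeasurableSpace.measurableSet_iInf

lemma tail_le : tail X ≤ MeasurableSpace.pi := (iInf_le _ 0).trans (tailFrom_le 0)

lemma measurable_tail_limitWeights :
    Measurable[tail X] (limitWeights p) := by
  intro B hB
  refine measurableSet_tail.2 fun n => ?_
  exact (@measurable_pi_lambda _ _ _ (tailFrom X n) _ _ fun k =>
    @measurable_pi_lambda _ _ _ (tailFrom X n) _ _ fun z =>
      measurable_tailFrom_limitWeights n k z) hB

variable (hP : IsPathLaw p s P) (hp : ∀ n y, ∑' x, p n y x = 1)
include hP hp

lemma IsPathLaw.setLIntegral_descend (k : ℕ) (z : X k) (j : ℕ) {A : Set (Π i, X i)}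
    (hA : MeasurableSet[tailFrom X (k + j)] A) :
    ∫⁻ ω in A, descend p k z j (ω (k + j)) ∂P = P ({ω | ω k = z} ∩ A) := by
  induction j with
  | zero =>
    refine (setLIntegral_comp_eval P k (Set.indicator {z} 1) A).trans ?_
    rw [tsum_eq_single z fun w hw => by simp [hw]]
    simp
  | succ j ih =>
    have hA' := antitone_tailFrom (Nat.le_succ (k + j)) _ hA
    have hmeas (w : X (k + j)) : Measurable fun ω : Π i, X i => p (k + j) (ω (k + j + 1)) w :=
      (Measurable.of_discrete (f := fun y => p (k + j) y w)).comp (measurable_pi_apply _)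
    calc ∫⁻ ω in A, ∑' w, p (k + j) (ω (k + j + 1)) w * descend p k z j w ∂P
        = ∑' w, descend p k z j w * P ({ω | ω (k + j) = w} ∩ A) := by
          rw [lintegral_tsum fun w => ((hmeas w).mul_const _).aemeasurable]
          refine tsum_congr fun w => ?_
          rw [lintegral_mul_const _ (hmeas w), hP.measure_eval_inter hp w hA, mul_comm]
      _ = P ({ω | ω k = z} ∩ A) := by rw [← setLIntegral_comp_eval, ih hA']

lemma IsPathLaw.ae_tendsto_descend (k : ℕ) (z : X k) :
    ∀ᵐ ω ∂P, Tendsto (fun j => descend p k z j (ω (k + j))) atTop (𝓝 (limitWeights p ω k z)) := by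
  have := hP.isProbabilityMeasure
  have hne (j : ℕ) (y : X (k + j)) : descend p k z j y ≠ ∞ :=
    ne_top_of_le_ne_top ENNReal.one_ne_top (descend_le_one hp k z j y)
  have hmeas {n : ℕ} (j : ℕ) (hn : n ≤ k + j) :
      Measurable[tailFrom X n] fun ω : Π i, X i => descend p k z j (ω (k + j)) :=
    (Measurable.of_discrete (f := descend p k z j)).comp (measurable_tailFrom_eval hn)
  have hint (j : ℕ) {A : Set (Π i, X i)} (hA : MeasurableSet[tailFrom X (k + j)] A) :
      ∫ ω in A, (descend p k z j (ω (k + j))).toReal ∂P = (P ({ω | ω k = z} ∩ A)).toReal := by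
    rw [integral_toReal ((hmeas j (Nat.zero_le _)).mono (tailFrom_le 0) le_rfl).aemeasurable
      (ae_of_all _ fun ω => (hne j _).lt_top), hP.setLIntegral_descend hp k z j hA]
  have hlim := ae_exists_tendsto_of_reverse_martingale (P := P) (F := fun j => tailFrom X (k + j))
    (f := fun j ω => (descend p k z j (ω (k + j))).toReal)
    (fun i j hij => antitone_tailFrom (Nat.add_le_add_left hij k)) (fun j => tailFrom_le _)
    (fun j => (hmeas j le_rfl).ennreal_toReal.stronglyMeasurable)
    (fun j ω => by
      rw [abs_of_nonneg ENNReal.toReal_nonneg]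
      exact ENNReal.toReal_le_of_le_ofReal zero_le_one (by simpa using descend_le_one hp k z j _))
    (fun j A hA => by
      rw [hint (j + 1) hA, hint j (antitone_tailFrom (Nat.le_succ (k + j)) _ hA)])
  filter_upwards [hlim] with ω ⟨l, hl⟩
  have h := ENNReal.tendsto_ofReal hl
  simp only [ENNReal.ofReal_toReal (hne _ _)] at h
  rwa [limitWeights, h.limsup_eq]

lemma IsPathLaw.setLIntegral_limitWeights (k : ℕ) (z : X k) {A : Set (Π i, X i)}
    (hA : MeasurableSet[tail X] A) :
    ∫⁻ ω in A, limitWeights p ω k z ∂P = P ({ω | ω k = z} ∩ A) := by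
  have := hP.isProbabilityMeasure
  have h := tendsto_lintegral_of_dominated_convergence (μ := P.restrict A) (fun _ => 1)
    (fun j => (Measurable.of_discrete (f := descend p k z j)).comp (measurable_pi_apply _))
    (fun j => ae_of_all _ fun ω => descend_le_one hp k z j (ω (k + j)))
    (by simp) (ae_restrict_of_ae (hP.ae_tendsto_descend hp k z))
  refine tendsto_nhds_unique h ?_
  simp only [Function.comp_def]
  simp only [hP.setLIntegral_descend hp k z _ (measurableSet_tail.1 hA _)]
  exact tendsto_const_nhds

lemma IsPathLaw.measure_window_inter_of_tail (k : ℕ) (x : Π i, X i) {A : Set (Π i, X i)}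
    (hA : MeasurableSet[tail X] A) :
    P (window 0 k x ∩ A) = ∫⁻ ω in A, limitWeights p ω k (x k) * weight p 0 k x ∂P := by
  rw [lintegral_mul_const _ (measurable_limitWeights_apply k _),
    hP.setLIntegral_limitWeights hp k _ hA,
    hP.measure_window_inter hp x (measurableSet_tail.1 hA k), mul_comm]

lemma IsPathLaw.ae_isCoherent_limitWeights : ∀ᵐ ω ∂P, IsCoherent p (limitWeights p ω) := by
  have := hP.isProbabilityMeasure
  have hmeas' (k : ℕ) (z : X k) : Measurable[tail X] fun ω => limitWeights p ω k z :=
    ((measurable_pi_apply z).comp (measurable_pi_apply k)).comp measurable_tail_limitWeights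
  have hmeas (k : ℕ) (z : X k) : Measurable fun ω => limitWeights p ω k z :=
    measurable_limitWeights_apply k z
  have h1 (n : ℕ) : (fun ω => ∑' x, limitWeights p ω n x) =ᵐ[P] fun _ => 1 := by
    refine ae_eq_of_forall_setLIntegral_eq_of_le tail_le
      (measurable_tsum_ennreal fun x => hmeas' n x) measurable_const fun A hA => ?_
    rw [lintegral_tsum fun x => (hmeas n x).aemeasurable, setLIntegral_one,
      measure_eq_tsum_inter_eval P n (tail_le A hA)]
    exact tsum_congr fun x => hP.setLIntegral_limitWeights hp n x hA
  have h2 (n : ℕ) (x : X n) : (fun ω => ∑' y, limitWeights p ω (n + 1) y * p n y x)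
      =ᵐ[P] fun ω => limitWeights p ω n x := by
    refine ae_eq_of_forall_setLIntegral_eq_of_le tail_le
      (measurable_tsum_ennreal fun y => (hmeas' (n + 1) y).mul_const _) (hmeas' n x) fun A hA => ?_
    rw [lintegral_tsum fun y => ((hmeas (n + 1) y).mul_const _).aemeasurable,
      hP.setLIntegral_limitWeights hp n x hA,
      hP.measure_eval_inter hp x (measurableSet_tail.1 hA (n + 1)),
      setLIntegral_comp_eval P (n + 1) (fun y => p n y x)]
    refine tsum_congr fun y => ?_
    rw [lintegral_mul_const _ (hmeas (n + 1) y), hP.setLIntegral_limitWeights hp _ y hA, mul_comm]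
  filter_upwards [ae_all_iff.2 h1, ae_all_iff.2 fun n => ae_all_iff.2 (h2 n)] with ω h3 h4
  exact ⟨h3, h4⟩

end Limit

section Boundary

variable [∀ n, Countable (X n)] [∀ n, Nonempty (X n)] [∀ n, DiscreteMeasurableSpace (X n)]

open Classical in
/-- The law of the path with marginals `s` descending according to `p`, for coherent `s`. -/
noncomputable def pathMeasure (p : ∀ n, X (n + 1) → X n → ℝ≥0∞) (s : ∀ n, X n → ℝ≥0∞) :
    Measure (Π i, X i) :=
  if h : IsCoherent p s then h.exists_isPathLaw.choose else 0

lemma IsCoherent.isPathLaw_pathMeasure (hs : IsCoherent p s) :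
    IsPathLaw p s (pathMeasure p s) := by
  rw [pathMeasure, dif_pos hs]
  exact hs.exists_isPathLaw.choose_spec

lemma pathMeasure_of_not_isCoherent (hs : ¬ IsCoherent p s) : pathMeasure p s = 0 :=
  dif_neg hs

lemma pathMeasure_univ_le_one : pathMeasure p s Set.univ ≤ 1 := by
  by_cases hs : IsCoherent p s
  · have := hs.isPathLaw_pathMeasure.isProbabilityMeasure
    exact prob_le_one
  · simp [pathMeasure_of_not_isCoherent hs]

instance : IsFiniteMeasure (pathMeasure p s) :=
  ⟨pathMeasure_univ_le_one.trans_lt ENNReal.one_lt_top⟩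

omit [∀ n, MeasurableSpace (X n)] [∀ n, Nonempty (X n)] [∀ n, DiscreteMeasurableSpace (X n)] in
lemma measurableSet_isCoherent : MeasurableSet {s | IsCoherent p s} := by
  have hmeas (n : ℕ) (x : X n) : Measurable fun s : (∀ n, X n → ℝ≥0∞) => s n x :=
    (measurable_pi_apply x).comp (measurable_pi_apply n)
  have h : {s | IsCoherent p s} = (⋂ n, {s | ∑' x, s n x = 1})
      ∩ ⋂ n, ⋂ x, {s | ∑' y, s (n + 1) y * p n y x = s n x} := by
    ext s
    simp only [Set.mem_inter_iff, Set.mem_iInter]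
    exact ⟨fun h => ⟨h.1, h.2⟩, fun h => ⟨h.1, h.2⟩⟩
  rw [h]
  refine (MeasurableSet.iInter fun n => measurableSet_eq_fun
    (measurable_tsum_ennreal fun x => hmeas n x) measurable_const).inter
    (.iInter fun n => .iInter fun x => measurableSet_eq_fun
      (measurable_tsum_ennreal fun y => (hmeas (n + 1) y).mul_const _) (hmeas n x))

lemma measurable_pathMeasure : Measurable (pathMeasure p) := by
  refine Measurable.measure_of_isPiSystem (tailFrom_zero (X := X)).symm (isPiSystem_window 0) ?_ ?_
  · rintro _ ⟨m, x, -, rfl⟩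
    have h : (fun s => pathMeasure p s (window 0 m x))
        = Set.indicator {s | IsCoherent p s} fun s => s m (x m) * weight p 0 m x := by
      ext s
      by_cases hs : IsCoherent p s
      · simp [hs, hs.isPathLaw_pathMeasure.measure_window]
      · simp [hs, pathMeasure_of_not_isCoherent]
    rw [h]
    exact (((measurable_pi_apply _).comp (measurable_pi_apply m)).mul_const _).indicator
      measurableSet_isCoherent
  · have h : (fun s => pathMeasure p s Set.univ) = Set.indicator {s | IsCoherent p s} 1 := by
      ext s
      by_cases hs : IsCoherent p s
      · have := hs.isPathLaw_pathMeasure.isProbabilityMeasure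
        simp [hs]
      · simp [hs, pathMeasure_of_not_isCoherent]
    rw [h]
    exact measurable_one.indicator measurableSet_isCoherent

/-- The laws of the paths, as a kernel indexed by the weights. -/
noncomputable def pathKernel (p : ∀ n, X (n + 1) → X n → ℝ≥0∞) :
    Kernel (∀ n, X n → ℝ≥0∞) (Π i, X i) :=
  ⟨pathMeasure p, measurable_pathMeasure⟩

instance : IsFiniteKernel (pathKernel p) :=
  ⟨1, ENNReal.one_lt_top, fun _ => pathMeasure_univ_le_one⟩

lemma IsPathLaw.setLIntegral_pathMeasure_limitWeights (hP : IsPathLaw p s P)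
    (hp : ∀ n y, ∑' x, p n y x = 1) {A E : Set (Π i, X i)} (hA : MeasurableSet[tail X] A)
    (hE : MeasurableSet E) :
    ∫⁻ ω in A, pathMeasure p (limitWeights p ω) E ∂P = P (E ∩ A) := by
  have := hP.isProbabilityMeasure
  let κ := (pathKernel p).comap (limitWeights p) measurable_limitWeights
  have hκ {E : Set (Π i, X i)} (hE : MeasurableSet E) :
      (P.restrict A).bind κ E = ∫⁻ ω in A, pathMeasure p (limitWeights p ω) E ∂P :=
    Measure.bind_apply hE κ.aemeasurable
  rw [← hκ hE, ← Measure.restrict_apply hE]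
  rw [← tailFrom_zero] at hE
  refine (measure_eq_of_window (fun m x _ => ?_) hE).symm
  rw [hκ (measurableSet_window 0 m x), Measure.restrict_apply (measurableSet_window 0 m x),
    hP.measure_window_inter_of_tail hp m x hA]
  refine lintegral_congr_ae (ae_restrict_of_ae ?_)
  filter_upwards [hP.ae_isCoherent_limitWeights hp] with ω hω
  rw [hω.isPathLaw_pathMeasure.measure_window]

/-- The conditional law of a path given its limit is concentrated on paths with that limit. -/
lemma IsPathLaw.ae_ae_limitWeights_eq (hP : IsPathLaw p s P) (hp : ∀ n y, ∑' x, p n y x = 1) :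
    ∀ᵐ ω ∂P, ∀ᵐ η ∂(pathMeasure p (limitWeights p ω)), limitWeights p η = limitWeights p ω := by
  have := hP.isProbabilityMeasure
  let κ := (pathKernel p).comap (limitWeights p) measurable_limitWeights
  have hq : Measurable (limitWeights p) := measurable_limitWeights
  have hqq : Measurable (Prod.map (limitWeights p) (limitWeights p)) := hq.prodMap hq
  have hmap : (P ⊗ₘ κ).map (Prod.map (limitWeights p) (limitWeights p))
      = P.map fun ω => (limitWeights p ω, limitWeights p ω) := by
    refine Measure.ext_prod fun {B C} hB hC => ?_
    rw [Measure.map_apply hqq (hB.prod hC), Measure.map_apply (hq.prodMk hq) (hB.prod hC),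
      Set.preimage_prod_map_prod, Measure.compProd_apply_prod (hq hB) (hq hC)]
    refine (hP.setLIntegral_pathMeasure_limitWeights hp (measurable_tail_limitWeights hB)
      (hq hC)).trans ?_
    rw [Set.inter_comm, Set.mk_preimage_prod]
  have hdiag : MeasurableSet {u : (∀ n, X n → ℝ≥0∞) × (∀ n, X n → ℝ≥0∞) | u.2 = u.1} :=
    measurableSet_eq_fun measurable_snd measurable_fst
  have h : ∀ᵐ u ∂(P ⊗ₘ κ), limitWeights p u.2 = limitWeights p u.1 := by
    refine (ae_map_iff hqq.aemeasurable hdiag).1 ?_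
    rw [hmap, ae_map_iff (hq.prodMk hq).aemeasurable hdiag]
    exact ae_of_all _ fun _ => rfl
  exact Measure.ae_ae_of_ae_compProd h

/-- The coherent families that are the almost sure limits of their own paths. -/
def boundary (p : ∀ n, X (n + 1) → X n → ℝ≥0∞) : Set (∀ n, X n → ℝ≥0∞) :=
  {s | IsCoherent p s ∧ ∀ᵐ ω ∂(pathMeasure p s), limitWeights p ω = s}

lemma measurableSet_boundary : MeasurableSet (boundary p) := by
  have h : MeasurableSet {u : (∀ n, X n → ℝ≥0∞) × (Π i, X i) | limitWeights p u.2 ≠ u.1} :=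
    (measurableSet_eq_fun (measurable_limitWeights.comp measurable_snd) measurable_fst).compl
  exact measurableSet_isCoherent.inter
    (Kernel.measurable_kernel_prodMk_left (κ := pathKernel p) h (measurableSet_singleton 0))

lemma IsPathLaw.ae_limitWeights_mem_boundary (hP : IsPathLaw p s P)
    (hp : ∀ n y, ∑' x, p n y x = 1) : ∀ᵐ ω ∂P, limitWeights p ω ∈ boundary p := by
  filter_upwards [hP.ae_isCoherent_limitWeights hp, hP.ae_ae_limitWeights_eq hp] with ω h1 h2
  exact ⟨h1, h2⟩

/-- The kernels from the boundary to the levels of the chain. -/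
noncomputable def boundaryKernel (p : ∀ n, X (n + 1) → X n → ℝ≥0∞) (n : ℕ) :
    Kernel (boundary p) (X n) :=
  ⟨fun s => ofWeights (s.1 n), measurable_ofWeights.comp
    ((measurable_pi_apply n).comp measurable_subtype_coe)⟩

lemma boundaryKernel_apply_singleton (n : ℕ) (s : boundary p) (x : X n) :
    boundaryKernel p n s {x} = s.1 n x :=
  ofWeights_singleton _ x

instance (n : ℕ) : IsMarkovKernel (boundaryKernel p n) :=
  ⟨fun s => isProbabilityMeasure_ofWeights (s.2.1.tsum_eq_one n)⟩

lemma bind_boundaryKernel_singleton (μ : Measure (boundary p)) (n : ℕ) (x : X n) :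
    μ.bind (boundaryKernel p n) {x} = ∫⁻ s, s.1 n x ∂μ := by
  rw [Measure.bind_apply (measurableSet_singleton x) (boundaryKernel p n).aemeasurable]
  simp only [boundaryKernel_apply_singleton]

lemma eq_of_forall_bind_boundaryKernel_eq {μ ν : Measure (boundary p)} [IsFiniteMeasure μ]
    (h : ∀ n, μ.bind (boundaryKernel p n) = ν.bind (boundaryKernel p n)) : μ = ν := by
  let κ := (pathKernel p).comap ((↑) : boundary p → _) measurable_subtype_coe
  have hκ (μ : Measure (boundary p)) {E : Set (Π i, X i)} (hE : MeasurableSet E) :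
      μ.bind κ E = ∫⁻ s, pathMeasure p s.1 E ∂μ :=
    Measure.bind_apply hE κ.aemeasurable
  have hwindow (μ : Measure (boundary p)) (m : ℕ) (x : Π i, X i) :
      μ.bind κ (window 0 m x) = μ.bind (boundaryKernel p m) {x m} * weight p 0 m x := by
    have hmeas : Measurable fun s : (∀ n, X n → ℝ≥0∞) => s m (x m) := by fun_prop
    have hmeas' : Measurable fun s : boundary p => s.1 m (x m) :=
      hmeas.comp measurable_subtype_coe
    rw [hκ μ (measurableSet_window 0 m x), bind_boundaryKernel_singleton,
      ← lintegral_mul_const _ hmeas']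
    exact lintegral_congr fun s => s.2.1.isPathLaw_pathMeasure.measure_window m x
  have hpre (μ : Measure (boundary p)) {B : Set (∀ n, X n → ℝ≥0∞)} (hB : MeasurableSet B) :
      μ.bind κ (limitWeights p ⁻¹' B) = μ ((↑) ⁻¹' B) := by
    rw [hκ μ (measurable_limitWeights hB), ← lintegral_indicator_one (measurable_subtype_coe hB)]
    refine lintegral_congr fun s => ?_
    have := s.2.1.isPathLaw_pathMeasure.isProbabilityMeasure
    by_cases hs : s.1 ∈ B
    · rw [Set.indicator_of_mem (show s ∈ Subtype.val ⁻¹' B from hs), Pi.one_apply,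
        ← mem_ae_iff_prob_eq_one (measurable_limitWeights hB)]
      filter_upwards [s.2.2] with ω hω
      rwa [Set.mem_preimage, hω]
    · rw [Set.indicator_of_notMem (show s ∉ Subtype.val ⁻¹' B from hs),
        measure_eq_zero_iff_ae_notMem]
      filter_upwards [s.2.2] with ω hω
      rwa [Set.mem_preimage, hω]
  ext E hE
  obtain ⟨B, hB, rfl⟩ := hE
  rw [← hpre μ hB, ← hpre ν hB]
  refine measure_eq_of_window (n := 0) (fun m x _ => by rw [hwindow, hwindow, h]) ?_
  rw [tailFrom_zero]
  exact measurable_limitWeights hB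

lemma IsCoherent.exists_measure_boundary (hs : IsCoherent p s) (hp : ∀ n y, ∑' x, p n y x = 1) :
    ∃ μ : Measure (boundary p), IsProbabilityMeasure μ ∧
      ∀ n x, μ.bind (boundaryKernel p n) {x} = s n x := by
  obtain ⟨P, hP⟩ := hs.exists_isPathLaw
  have := hP.isProbabilityMeasure
  have hq : Measurable (limitWeights p) := measurable_limitWeights
  have hmap : ((P.map (limitWeights p)).comap Subtype.val).map (Subtype.val : boundary p → _)
      = P.map (limitWeights p) := by
    rw [map_comap_subtype_coe measurableSet_boundary, Measure.restrict_eq_self_of_ae_mem]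
    exact (ae_map_iff hq.aemeasurable measurableSet_boundary).2 (hP.ae_limitWeights_mem_boundary hp)
  have := Measure.isProbabilityMeasure_map (μ := P) hq.aemeasurable
  refine ⟨(P.map (limitWeights p)).comap Subtype.val,
    (Measure.isProbabilityMeasure_map_iff measurable_subtype_coe.aemeasurable).1
      (by rwa [hmap]), fun n x => ?_⟩
  have hmeas : Measurable fun s : (∀ n, X n → ℝ≥0∞) => s n x := by fun_prop
  rw [bind_boundaryKernel_singleton, ← lintegral_map hmeas measurable_subtype_coe, hmap,
    lintegral_map hmeas hq, ← setLIntegral_univ, hP.setLIntegral_limitWeights hp n x .univ,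
    Set.inter_univ]
  obtain ⟨x, rfl⟩ : ∃ ω : Π i, X i, ω n = x := Function.surjective_eval n x
  have hset : {ω : Π i, X i | ω n = x n} = window n n x := by
    ext ω
    exact ⟨fun h i h1 h2 => by rwa [le_antisymm h2 h1], fun h => h n le_rfl le_rfl⟩
  rw [hset, hP.measure_window_of_le hp le_rfl, weight_self, mul_one]

end Boundary

lemma bind_kernel_singleton {α β : Type*} [MeasurableSpace α] [DiscreteMeasurableSpace α]
    [Countable α] [MeasurableSpace β] [MeasurableSingletonClass β] (μ : Measure α)
    (κ : Kernel α β) (x : β) : μ.bind κ {x} = ∑' y, μ {y} * κ y {x} := by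
  rw [Measure.bind_apply (measurableSet_singleton x) κ.aemeasurable, lintegral_countable']
  exact tsum_congr fun y => mul_comm _ _

lemma tsum_measure_singleton {α : Type*} [MeasurableSpace α] [DiscreteMeasurableSpace α]
    [Countable α] (μ : Measure α) [IsProbabilityMeasure μ] : ∑' x, μ {x} = 1 := by
  rw [← measure_univ (μ := μ), ← lintegral_one, lintegral_countable']
  simp

end ProjectiveChain

/-- Existence of the boundary of a projective chain (Theorem 5.A): given nonempty countable
discrete measurable spaces `X 0, X 1, X 2, …` (here `X N` plays the role of `X_{N+1}`) and
Markov kernels `Λ N : X (N+1) ⇢ X N`, there exist a measurable space `Xinf` and Markov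
kernels `Linf N : Xinf ⇢ X N` compatible with the links, such that pushing forward along
the `Linf N` is a bijection between probability measures on `Xinf` and coherent families. -/
theorem projective_boundary_exists
    (X : ℕ → Type) [∀ N, MeasurableSpace (X N)] [∀ N, DiscreteMeasurableSpace (X N)]
    [∀ N, Countable (X N)] [∀ N, Nonempty (X N)]
    (Λ : (N : ℕ) → Kernel (X (N + 1)) (X N))
    (hΛ : ∀ N, IsMarkovKernel (Λ N)) :
    ∃ (Xinf : Type) (_ : MeasurableSpace Xinf) (Linf : (N : ℕ) → Kernel Xinf (X N)),
      (∀ N, IsMarkovKernel (Linf N)) ∧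
      -- compatibility: `Λ^∞_N ∘ Λ^N_{N-1} = Λ^∞_{N-1}`
      (∀ N, (Λ N) ∘ₖ (Linf (N + 1)) = Linf N) ∧
      -- the pushforwards of a probability measure form a coherent family of
      -- probability measures
      (∀ μ : Measure Xinf, IsProbabilityMeasure μ →
        (∀ N, IsProbabilityMeasure (μ.bind (Linf N))) ∧
        (∀ N, (μ.bind (Linf (N + 1))).bind (Λ N) = μ.bind (Linf N))) ∧
      -- injectivity
      (∀ μ ν : Measure Xinf, IsProbabilityMeasure μ → IsProbabilityMeasure ν →
        (∀ N, μ.bind (Linf N) = ν.bind (Linf N)) → μ = ν) ∧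
      -- surjectivity onto coherent families
      (∀ M : (N : ℕ) → Measure (X N), (∀ N, IsProbabilityMeasure (M N)) →
        (∀ N, (M (N + 1)).bind (Λ N) = M N) →
        ∃ μ : Measure Xinf, IsProbabilityMeasure μ ∧ ∀ N, μ.bind (Linf N) = M N) := by
  let p (N : ℕ) (y : X (N + 1)) (x : X N) : ENNReal := Λ N y {x}
  have hp (N : ℕ) (y : X (N + 1)) : ∑' x, p N y x = 1 :=
    ProjectiveChain.tsum_measure_singleton (Λ N y)
  have hcomp (N : ℕ) : Λ N ∘ₖ ProjectiveChain.boundaryKernel p (N + 1)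
      = ProjectiveChain.boundaryKernel p N := by
    ext1 s
    refine Measure.ext_of_singleton fun x => ?_
    rw [Kernel.comp_apply, ProjectiveChain.bind_kernel_singleton]
    simp only [ProjectiveChain.boundaryKernel_apply_singleton]
    exact s.2.1.tsum_mul_eq N x
  refine ⟨ProjectiveChain.boundary p, inferInstance, ProjectiveChain.boundaryKernel p,
    fun N => inferInstance, hcomp, fun μ hμ => ⟨fun N => inferInstance, fun N => ?_⟩,
    fun μ ν _ _ h => ProjectiveChain.eq_of_forall_bind_boundaryKernel_eq h, fun M hM hMΛ => ?_⟩
  · rw [Measure.comp_assoc, hcomp]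
  · have hs : ProjectiveChain.IsCoherent p fun N x => M N {x} :=
      ⟨fun N => ProjectiveChain.tsum_measure_singleton (M N), fun N x => by
        rw [← hMΛ N, ProjectiveChain.bind_kernel_singleton]⟩
    obtain ⟨μ, hμ, h⟩ := hs.exists_measure_boundary hp
    exact ⟨μ, hμ, fun N => Measure.ext_of_singleton (h N)⟩
end
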